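/- arXiv:2302.05537 — 4 statements merged into one kernel-verified Lean document; each statement's English description precedes it below -/
import Mathlib

section
/- There exist absolute constants c ≥ 1 and C ≥ 1 such that the following holds. Let F be a finite field with q elements, n ≥ 1, and let A, B ⊆ 𝔽_q^n each have cardinality at least 2^{−d}·q^n for some real d ≥ 1. Let k ≥ 1 be an integer, ε ∈ (0, 1/4], and let r be a positive integer with r ≥ d⁴·k⁴/ε^c. If both A and B are (1 + ε, r)-spread — i.e., for every affine subspace V of 𝔽_q^n of codimension at most r, |A ∩ V| · q^n ≤ (1 + ε) · |A| · |V| and |B ∩ V| · q^n ≤ (1 + ε) · |B| · |V| — then ‖A * B − 1‖_k ≤ C·ε, where A and B also denote the density functions of these sets. -/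
open scoped Classical

/-- The density function of a set `A ⊆ G`: `(|G|/|A|)·1_A`. -/
noncomputable def dens {G : Type*} [Fintype G] (A : Finset G) : G → ℝ :=
  fun x => if x ∈ A then (Fintype.card G : ℝ) / (A.card : ℝ) else 0

/-- Convolution: `(f * g)(x) = E_{y∈G} f(y)·g(x − y)`. -/
noncomputable def convC {G : Type*} [AddCommGroup G] [Fintype G] (f g : G → ℝ) : G → ℝ :=
  fun x => (∑ y, f y * g (x - y)) / (Fintype.card G : ℝ)

/-- The normalized `k`-norm: `‖f‖_k = (E_{x∈G} |f(x)|^k)^{1/k}`. -/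
noncomputable def knorm {G : Type*} [Fintype G] (k : ℕ) (f : G → ℝ) : ℝ :=
  ((∑ x, |f x| ^ k) / (Fintype.card G : ℝ)) ^ ((1:ℝ)/(k:ℝ))

/-- The unnormalised autocorrelation of `f`. -/
noncomputable def autocorr {G : Type*} [AddCommGroup G] [Fintype G] (f : G → ℝ) (t : G) : ℝ :=
  ∑ z, f z * f (z + t)

section autocorrelation

variable {G : Type*} [AddCommGroup G] [Fintype G]

theorem sum_shift_mul_shift (f : G → ℝ) (s s' : G) :
    ∑ z, f (z + s) * f (z + s') = autocorr f (s' - s) := by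
  rw [autocorr, ← Equiv.sum_comp (Equiv.addRight s) fun z => f z * f (z + (s' - s))]
  simp [add_assoc]

theorem sum_sum_sub (φ : G → ℝ) :
    ∑ s : G, ∑ s' : G, φ (s' - s) = Fintype.card G * ∑ t, φ t := by
  have (s : G) : ∑ s' : G, φ (s' - s) = ∑ t, φ t := Equiv.sum_comp (Equiv.subRight s) φ
  simp [this]

theorem sum_sq_sum_prod_shift (f : G → ℝ) (k : ℕ) :
    ∑ z : Fin k → G, (∑ s, ∏ i, f (z i + s)) ^ 2 =
      Fintype.card G * ∑ t, autocorr f t ^ k := by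
  rw [← sum_sum_sub fun t => autocorr f t ^ k]
  simp_rw [sq, Finset.sum_mul_sum, ← sum_shift_mul_shift, Fintype.sum_pow, Finset.prod_mul_distrib]
  rw [Finset.sum_comm]
  refine Finset.sum_congr rfl fun s _ => Finset.sum_comm

theorem sum_autocorr_pow_nonneg (f : G → ℝ) (k : ℕ) : 0 ≤ ∑ t, autocorr f t ^ k := by
  have h : 0 ≤ (Fintype.card G : ℝ) * ∑ t, autocorr f t ^ k := by
    rw [← sum_sq_sum_prod_shift]
    positivity
  exact nonneg_of_mul_nonneg_right h (by exact_mod_cast Fintype.card_pos)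

theorem card_mul_sum_conv_pow (f g : G → ℝ) (k : ℕ) :
    Fintype.card G * ∑ x, (∑ y, f y * g (x - y)) ^ k =
      ∑ z : Fin k → G, (∑ s, ∏ i, f (z i + s)) * ∑ x, ∏ i, g (x - z i) := by
  have key (s : G) : ∑ x, (∑ y, f y * g (x - y)) ^ k =
      ∑ z : Fin k → G, ∑ x, (∏ i, f (z i + s)) * ∏ i, g (x - z i) := by
    rw [Finset.sum_comm, ← Equiv.sum_comp (Equiv.addRight s)]
    refine Finset.sum_congr rfl fun x _ => ?_
    rw [← Equiv.sum_comp (Equiv.addRight s)]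
    simp [Fintype.sum_pow, Finset.prod_mul_distrib]
  simp_rw [Finset.sum_mul_sum]
  rw [Finset.sum_comm]
  simp [← key]

theorem sq_sum_conv_pow_le (f g : G → ℝ) (k : ℕ) :
    (∑ x, (∑ y, f y * g (x - y)) ^ k) ^ 2 ≤
      (∑ t, autocorr f t ^ k) * ∑ t, autocorr g t ^ k := by
  have hN : (0 : ℝ) < Fintype.card G := by exact_mod_cast Fintype.card_pos
  have hg : ∑ z : Fin k → G, (∑ x, ∏ i, g (x - z i)) ^ 2 =
      Fintype.card G * ∑ t, autocorr g t ^ k := by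
    rw [← sum_sq_sum_prod_shift, ← Equiv.sum_comp (Equiv.neg (Fin k → G))]
    simp [add_comm]
  have h := Finset.sum_mul_sq_le_sq_mul_sq Finset.univ
    (fun z : Fin k → G => ∑ s, ∏ i, f (z i + s)) (fun z => ∑ x, ∏ i, g (x - z i))
  rw [← card_mul_sum_conv_pow, sum_sq_sum_prod_shift, hg] at h
  refine le_of_mul_le_mul_left ?_ (pow_pos hN 2)
  linarith

end autocorrelation

section sifting

variable {G : Type*} [AddCommGroup G] [Fintype G]

/-- The points all of whose translates by the `s i` lie in `A`. -/
noncomputable def commonShift (A : Finset G) {p : ℕ} (s : Fin p → G) : Finset G :=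
  Finset.univ.filter fun x => ∀ i, x + s i ∈ A

theorem indicator_commonShift (A : Finset G) {p : ℕ} (s : Fin p → G) (x : G) :
    (if x ∈ commonShift A s then (1 : ℝ) else 0) = ∏ i, if x + s i ∈ A then (1 : ℝ) else 0 := by
  rw [Finset.prod_ite_zero]
  simp [commonShift]

theorem sum_card_commonShift (A : Finset G) (p : ℕ) :
    ∑ s : Fin p → G, ((commonShift A s).card : ℝ) = Fintype.card G * (A.card : ℝ) ^ p := by
  have (s : Fin p → G) : ((commonShift A s).card : ℝ) =
      ∑ x, ∏ i, if x + s i ∈ A then (1 : ℝ) else 0 := by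
    simp_rw [← indicator_commonShift]
    simp
  simp_rw [this]
  rw [Finset.sum_comm]
  have h (x : G) : ∑ s : Fin p → G, ∏ i, (if x + s i ∈ A then (1 : ℝ) else 0) =
      (A.card : ℝ) ^ p := by
    rw [← Fintype.sum_pow (fun u => if x + u ∈ A then (1 : ℝ) else 0)]
    congr 1
    refine (Equiv.sum_comp (Equiv.addLeft x) fun u => if u ∈ A then (1 : ℝ) else 0).trans ?_
    simp
  simp [h]

theorem sum_weighted_pairs_commonShift (A : Finset G) (p : ℕ) (φ : G → ℝ) :
    ∑ s : Fin p → G, ∑ x ∈ commonShift A s, ∑ y ∈ commonShift A s, φ (y - x) =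
      Fintype.card G * ∑ t, φ t * autocorr (fun x => if x ∈ A then 1 else 0) t ^ p := by
  rw [← sum_sum_sub fun t => φ t * autocorr (fun x => if x ∈ A then 1 else 0) t ^ p]
  have (s : Fin p → G) : ∑ x ∈ commonShift A s, ∑ y ∈ commonShift A s, φ (y - x) =
      ∑ x, ∑ y, φ (y - x) * ∏ i, ((if x + s i ∈ A then (1 : ℝ) else 0) *
        (if y + s i ∈ A then (1 : ℝ) else 0)) := by
    simp_rw [Finset.prod_mul_distrib, ← indicator_commonShift]
    simp
  simp_rw [this]
  rw [Finset.sum_comm]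
  refine Finset.sum_congr rfl fun x _ => ?_
  rw [Finset.sum_comm]
  refine Finset.sum_congr rfl fun y _ => ?_
  rw [← Finset.mul_sum]
  congr 1
  rw [← Fintype.sum_pow (fun u => (if x + u ∈ A then (1 : ℝ) else 0) *
        (if y + u ∈ A then (1 : ℝ) else 0)), ← sum_shift_mul_shift]
  simp_rw [add_comm]

/-- Sifting: if the large values of the autocorrelation of `A` carry most of its `p`-th moment,
some large set has most of its differences there. -/
theorem exists_sifted_set (A S : Finset G) (p : ℕ) {δ : ℝ} (hδ : 0 < δ)
    (hS : ∑ t ∈ Sᶜ, autocorr (fun x => if x ∈ A then 1 else 0) t ^ p ≤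
      δ * ∑ t, autocorr (fun x => if x ∈ A then 1 else 0) t ^ p)
    (hA : (A.card : ℝ) ^ (2 * p) <
      (Fintype.card G : ℝ) ^ p / Fintype.card G *
        ∑ t, autocorr (fun x => if x ∈ A then 1 else 0) t ^ p) :
    ∃ A' : Finset G,
      ((A.card : ℝ) / Fintype.card G) ^ p / 2 * Fintype.card G < A'.card ∧
      ∑ x ∈ A', ∑ y ∈ A', (if y - x ∈ S then (0 : ℝ) else 1) ≤ 2 * δ * (A'.card : ℝ) ^ 2 := by
  set N : ℝ := (Fintype.card G : ℝ) with hNdef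
  have hN : (0 : ℝ) < N := by simp only [hNdef]; exact_mod_cast Fintype.card_pos
  set X := ∑ t, autocorr (fun x => if x ∈ A then 1 else 0) t ^ p with hX
  set a : ℝ := (A.card : ℝ) with ha
  have h2 := sum_weighted_pairs_commonShift A p fun _ => 1
  have h3 := sum_weighted_pairs_commonShift A p fun t => if t ∈ S then 0 else 1
  have h1 := sum_card_commonShift A p
  simp only [Finset.sum_const, nsmul_eq_mul, mul_one, one_mul] at h2
  have h4 : ∑ t, (if t ∈ S then (0 : ℝ) else 1) *
      autocorr (fun x => if x ∈ A then 1 else 0) t ^ p =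
      ∑ t ∈ Sᶜ, autocorr (fun x => if x ∈ A then 1 else 0) t ^ p := by
    simp only [ite_mul, zero_mul, one_mul]
    rw [← Finset.sum_add_sum_compl S]
    rw [Finset.sum_congr rfl fun t ht => if_pos ht,
      Finset.sum_congr rfl fun t ht => if_neg (Finset.mem_compl.1 ht)]
    simp
  rw [h4] at h3
  have hpos : 0 < ∑ s : Fin p → G, (((commonShift A s).card : ℝ) * (commonShift A s).card
      - (∑ x ∈ commonShift A s, ∑ y ∈ commonShift A s, if y - x ∈ S then (0 : ℝ) else 1) / (2 * δ)
      - (a / N) ^ p / 2 * N * (commonShift A s).card) := by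
    rw [Finset.sum_sub_distrib, Finset.sum_sub_distrib, ← Finset.sum_div, ← Finset.mul_sum,
      h1, h2, h3]
    have e1 : N * (∑ t ∈ Sᶜ, autocorr (fun x => if x ∈ A then 1 else 0) t ^ p) / (2 * δ) ≤
        N * X / 2 := by
      rw [div_le_div_iff₀ (by positivity) (by positivity)]
      nlinarith
    have e2 : (a / N) ^ p / 2 * N * (N * a ^ p) < N * X / 2 := by
      have : (a / N) ^ p / 2 * N * (N * a ^ p) = N * (a ^ (2 * p) / (N ^ p / N)) / 2 := by
        rw [div_pow]
        field_simp
        rw [pow_mul', sq]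
      rw [this]
      gcongr
      rw [div_lt_iff₀ (by positivity)]
      linarith
    linarith
  obtain ⟨s, -, hs⟩ := Finset.exists_lt_of_sum_lt
    ((Finset.sum_const_zero (s := (Finset.univ : Finset (Fin p → G)))).trans_lt hpos)
  refine ⟨commonShift A s, ?_, ?_⟩
  all_goals
    set b := ∑ x ∈ commonShift A s, ∑ y ∈ commonShift A s, (if y - x ∈ S then (0 : ℝ) else 1)
    have hb : 0 ≤ b := Finset.sum_nonneg fun x _ => Finset.sum_nonneg fun y _ => by
      split_ifs <;> norm_num
    have ha0 : 0 ≤ (a / N) ^ p / 2 * N := by positivity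
    set m : ℝ := ((commonShift A s).card : ℝ)
    have hm : 0 ≤ m := by positivity
    have hb' : 0 ≤ b / (2 * δ) := by positivity
  · by_contra! hc
    nlinarith
  · have : b / (2 * δ) ≤ m ^ 2 := by nlinarith [mul_nonneg ha0 hm]
    rwa [div_le_iff₀ (by positivity), mul_comm] at this

end sifting

section concentration

theorem sum_exp_mul_le {α : Type*} [Fintype α] {f : α → ℝ} (hf : ∀ a, |f a| ≤ 1)
    (h0 : ∑ a, f a = 0) (t : ℝ) :
    ∑ a, Real.exp (t * f a) ≤ Fintype.card α * Real.exp (t ^ 2 / 2) := by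
  calc ∑ a, Real.exp (t * f a) ≤ ∑ a, (Real.cosh t + f a * Real.sinh t) := by
        refine Finset.sum_le_sum fun a _ => ?_
        rw [mul_comm]
        exact Real.exp_mul_le_cosh_add_mul_sinh (hf a) t
    _ = Fintype.card α * Real.cosh t := by
        rw [Finset.sum_add_distrib, ← Finset.sum_mul, h0]
        simp
    _ ≤ _ := by
        gcongr
        exact Real.cosh_le_exp_half_sq t

theorem sum_exp_mul_sum_le {α : Type*} [Fintype α] {f : α → ℝ} (hf : ∀ a, |f a| ≤ 1)
    (h0 : ∑ a, f a = 0) (k : ℕ) (t : ℝ) :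
    ∑ a : Fin k → α, Real.exp (t * ∑ i, f (a i)) ≤
      (Fintype.card α : ℝ) ^ k * Real.exp (k * t ^ 2 / 2) := by
  calc ∑ a : Fin k → α, Real.exp (t * ∑ i, f (a i)) = (∑ a, Real.exp (t * f a)) ^ k := by
        simp_rw [Fintype.sum_pow, Finset.mul_sum, Real.exp_sum]
    _ ≤ (Fintype.card α * Real.exp (t ^ 2 / 2)) ^ k := by
        gcongr
        exact sum_exp_mul_le hf h0 t
    _ = _ := by
        rw [mul_pow, ← Real.exp_nat_mul]
        ring_nf

/-- Hoeffding's inequality for uniform samples. -/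
theorem card_large_deviation_le {α : Type*} [Fintype α] {f : α → ℝ} (hf : ∀ a, |f a| ≤ 1)
    (h0 : ∑ a, f a = 0) (k : ℕ) {η : ℝ} (hη : 0 < η) :
    ((Finset.univ.filter fun a : Fin k → α => k * η < |∑ i, f (a i)|).card : ℝ) ≤
      2 * Real.exp (-(k * η ^ 2 / 2)) * (Fintype.card α : ℝ) ^ k := by
  have h1 := sum_exp_mul_sum_le hf h0 k η
  have h2 := sum_exp_mul_sum_le hf h0 k (-η)
  rw [neg_sq] at h2
  have h3 : ((Finset.univ.filter fun a : Fin k → α => k * η < |∑ i, f (a i)|).card : ℝ) ≤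
      ∑ a : Fin k → α, Real.exp (-(k * η ^ 2)) *
        (Real.exp (η * ∑ i, f (a i)) + Real.exp (-η * ∑ i, f (a i))) := by
    rw [Finset.card_filter]
    push_cast
    refine Finset.sum_le_sum fun a _ => ?_
    split_ifs with h
    · rw [mul_add, ← Real.exp_add, ← Real.exp_add]
      rcases lt_abs.1 h with h | h
      · have : 1 ≤ Real.exp (-(k * η ^ 2) + η * ∑ i, f (a i)) := by
          apply Real.one_le_exp
          nlinarith
        have := Real.exp_pos (-(k * η ^ 2) + -η * ∑ i, f (a i))
        linarith
      · have : 1 ≤ Real.exp (-(k * η ^ 2) + -η * ∑ i, f (a i)) := by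
          apply Real.one_le_exp
          nlinarith
        have := Real.exp_pos (-(k * η ^ 2) + η * ∑ i, f (a i))
        linarith
    · positivity
  rw [← Finset.mul_sum, Finset.sum_add_distrib] at h3
  have h4 : Real.exp (-(k * η ^ 2)) * Real.exp (k * η ^ 2 / 2) = Real.exp (-(k * η ^ 2 / 2)) := by
    rw [← Real.exp_add]
    ring_nf
  rw [← h4]
  have := Real.exp_pos (-(k * η ^ 2))
  nlinarith

end concentration

section almost_periodicity

variable {G : Type*} [AddCommGroup G]

/-- The proportion of `b ∈ A` with `x + b ∈ S`. -/
noncomputable def shiftMean (A S : Finset G) (x : G) : ℝ :=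
  (∑ b ∈ A, if x + b ∈ S then (1 : ℝ) else 0) / A.card

/-- The proportion of pairs `a, b ∈ A` with `x + b - a ∈ S`. -/
noncomputable def diffMean (A S : Finset G) (x : G) : ℝ :=
  (∑ a ∈ A, shiftMean A S (x - a)) / A.card

theorem shiftMean_mem_Icc (A S : Finset G) (x : G) : shiftMean A S x ∈ Set.Icc (0 : ℝ) 1 := by
  have h0 : ∀ b, 0 ≤ if x + b ∈ S then (1 : ℝ) else 0 := fun b => by split_ifs <;> norm_num
  refine ⟨div_nonneg (Finset.sum_nonneg fun b _ => h0 b) (by positivity), ?_⟩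
  refine div_le_one_of_le₀ ?_ (by positivity)
  calc (∑ b ∈ A, if x + b ∈ S then (1 : ℝ) else 0) ≤ ∑ b ∈ A, 1 := by
        refine Finset.sum_le_sum fun b _ => ?_
        split_ifs <;> norm_num
    _ = _ := by simp

/-- The sample `b` misjudges the proportion of `A` that lies in `S - x`. -/
def IsBadSample (A S : Finset G) (η : ℝ) {k : ℕ} (b : Fin k → G) (x : G) : Prop :=
  k * η < |∑ i, ((if x + b i ∈ S then (1 : ℝ) else 0) - shiftMean A S x)|

theorem card_bad_samples_le {A : Finset G} (hA : A.Nonempty) (S : Finset G) (k : ℕ) {η : ℝ}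
    (hη : 0 < η) (x : G) :
    ((Finset.univ.filter fun a : Fin k → A =>
      IsBadSample A S η (fun i => (a i : G)) x).card : ℝ) ≤
      2 * Real.exp (-(k * η ^ 2 / 2)) * (A.card : ℝ) ^ k := by
  have hc : (A.card : ℝ) ≠ 0 := by exact_mod_cast hA.card_pos.ne'
  have h := card_large_deviation_le (α := A)
    (f := fun b => (if x + b ∈ S then (1 : ℝ) else 0) - shiftMean A S x) ?_ ?_ k hη
  · rwa [Fintype.card_coe] at h
  · intro b
    obtain ⟨h0, h1⟩ := shiftMean_mem_Icc A S x
    rw [abs_le]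
    split_ifs <;> constructor <;> linarith
  · rw [Finset.sum_sub_distrib, Finset.sum_coe_sort A fun b => if x + b ∈ S then (1 : ℝ) else 0]
    simp only [Finset.sum_const, Finset.card_univ, Fintype.card_coe, nsmul_eq_mul, shiftMean]
    field_simp
    simp

variable [Fintype G]

/-- The samples from `A` that are bad for few points. -/
noncomputable def goodSamples (A S : Finset G) (η : ℝ) (k : ℕ) : Finset (Fin k → G) :=
  Finset.univ.filter fun b => (∀ i, b i ∈ A) ∧
    ((Finset.univ.filter fun x => IsBadSample A S η b x).card : ℝ) ≤
      4 * Real.exp (-(k * η ^ 2 / 2)) * Fintype.card G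

theorem le_card_goodSamples {A : Finset G} (hA : A.Nonempty) (S : Finset G) (k : ℕ) {η : ℝ}
    (hη : 0 < η) : (A.card : ℝ) ^ k / 2 ≤ (goodSamples A S η k).card := by
  set N : ℝ := (Fintype.card G : ℝ) with hNdef
  have hN : (0 : ℝ) < N := by simp only [hNdef]; exact_mod_cast Fintype.card_pos
  set β := Real.exp (-(k * η ^ 2 / 2)) with hβ
  have hβ0 : 0 < β := Real.exp_pos _
  let P : (Fin k → A) → Prop := fun a =>
    ((Finset.univ.filter fun x => IsBadSample A S η (fun i => (a i : G)) x).card : ℝ) ≤ 4 * β * N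
  have htot : ∑ a : Fin k → A,
      ((Finset.univ.filter fun x => IsBadSample A S η (fun i => (a i : G)) x).card : ℝ) ≤
      2 * β * A.card ^ k * N := by
    simp_rw [Finset.card_filter]
    push_cast
    rw [Finset.sum_comm]
    calc _ ≤ ∑ x : G, 2 * β * (A.card : ℝ) ^ k := by
          refine Finset.sum_le_sum fun x _ => ?_
          have := card_bad_samples_le hA S k hη x
          rw [Finset.card_filter] at this
          push_cast at this
          exact this
      _ = _ := by simp [hNdef]; ring
  have hsplit : ((Finset.univ.filter P).card : ℝ) + (Finset.univ.filter fun a => ¬ P a).card =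
      (A.card : ℝ) ^ k := by
    have := Finset.card_filter_add_card_filter_not (s := (Finset.univ : Finset (Fin k → A))) P
    rw [Finset.card_univ, Fintype.card_fun, Fintype.card_coe, Fintype.card_fin] at this
    exact_mod_cast this
  have hbad : ((Finset.univ.filter fun a => ¬ P a).card : ℝ) * (4 * β * N) ≤
      2 * β * A.card ^ k * N := by
    refine le_trans ?_ htot
    rw [← nsmul_eq_mul]
    refine (Finset.card_nsmul_le_sum _ _ _ fun a ha => ?_).trans
      (Finset.sum_le_sum_of_subset_of_nonneg (Finset.filter_subset _ _) fun _ _ _ => by positivity)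
    exact (not_le.1 (Finset.mem_filter.1 ha).2).le
  have hbad' : ((Finset.univ.filter fun a => ¬ P a).card : ℝ) ≤ (A.card : ℝ) ^ k / 2 := by
    refine le_of_mul_le_mul_right (hbad.trans_eq ?_) (show 0 < 4 * β * N by positivity)
    ring
  have hinj : (Finset.univ.filter P).card ≤ (goodSamples A S η k).card := by
    refine Finset.card_le_card_of_injOn (fun a i => (a i : G)) ?_ ?_
    · intro a ha
      have := (Finset.mem_filter.1 ha).2
      simp only [goodSamples, Finset.coe_filter, Finset.mem_univ, true_and, Set.mem_ofPred_eq]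
      exact ⟨fun i => (a i).2, this⟩
    · intro a _ b _ hab
      funext i
      exact Subtype.ext (congrFun hab i)
  have : ((Finset.univ.filter P).card : ℝ) ≤ (goodSamples A S η k).card := by exact_mod_cast hinj
  linarith

/-- Some translate of the diagonal meets a set of tuples at least as often as average. -/
theorem exists_dense_diagonal {k : ℕ} (L : Finset (Fin k → G)) :
    ∃ b : Fin k → G, (L.card : ℝ) * Fintype.card G ≤
      ((Finset.univ.filter fun g => (fun i => b i - g) ∈ L).card : ℝ) *
        (Fintype.card G : ℝ) ^ k := by
  by_contra! h
  have h1 : ∑ b : Fin k → G, ((Finset.univ.filter fun g => (fun i => b i - g) ∈ L).card : ℝ) =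
      L.card * Fintype.card G := by
    simp_rw [Finset.card_filter]
    push_cast
    rw [Finset.sum_comm]
    have (g : G) : ∑ b : Fin k → G, (if (fun i => b i - g) ∈ L then (1 : ℝ) else 0) = L.card := by
      refine (Equiv.sum_comp (Equiv.subRight fun _ : Fin k => g)
        fun b => if b ∈ L then (1 : ℝ) else 0).trans ?_
      simp
    simp [this, mul_comm]
  have h2 := Finset.sum_lt_sum_of_nonempty (s := (Finset.univ : Finset (Fin k → G)))
    Finset.univ_nonempty fun b _ => h b
  rw [← Finset.sum_mul, h1] at h2
  simp [mul_comm] at h2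

/-- Croot–Sisask almost-periodicity. -/
theorem exists_almost_periods {A : Finset G} (hA : A.Nonempty) (S : Finset G) {k : ℕ} (hk : 0 < k)
    {η : ℝ} (hη : 0 < η)
    (hsample : 4 * Real.exp (-(k * η ^ 2 / 2)) * Fintype.card G ≤ η * A.card) :
    ∃ (T : Finset G) (H : G → ℝ),
      ((A.card : ℝ) / Fintype.card G) ^ k / 2 * Fintype.card G ≤ T.card ∧
      ∀ g ∈ T, ∀ x, |diffMean A S (x + g) - H x| ≤ 2 * η := by
  have hN : (0 : ℝ) < Fintype.card G := by exact_mod_cast Fintype.card_pos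
  have hc : (0 : ℝ) < A.card := by exact_mod_cast hA.card_pos
  have hk' : (0 : ℝ) < k := by exact_mod_cast hk
  obtain ⟨b, hb⟩ := exists_dense_diagonal (goodSamples A S η k)
  let B : G → ℝ := fun y => (∑ i, if y + b i ∈ S then (1 : ℝ) else 0) / k
  have hB (y : G) : B y ∈ Set.Icc (0 : ℝ) 1 := by
    refine ⟨div_nonneg (Finset.sum_nonneg fun i _ => by split_ifs <;> norm_num) hk'.le, ?_⟩
    refine div_le_one_of_le₀ ?_ hk'.le
    calc (∑ i, if y + b i ∈ S then (1 : ℝ) else 0) ≤ ∑ i : Fin k, (1 : ℝ) := by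
          refine Finset.sum_le_sum fun b _ => ?_
          split_ifs <;> norm_num
      _ = _ := by simp
  refine ⟨Finset.univ.filter fun g => (fun i => b i - g) ∈ goodSamples A S η k,
    fun x => (∑ a ∈ A, B (x - a)) / A.card, ?_, fun g hg x => ?_⟩
  · have h := (mul_le_mul_of_nonneg_right (le_card_goodSamples hA S k hη) hN.le).trans hb
    rw [div_pow, ← div_le_iff₀ (by positivity)] at *
    refine le_trans (le_of_eq ?_) h
    field_simp
  · obtain ⟨-, hg⟩ := Finset.mem_filter.1 hg
    obtain ⟨-, -, hg⟩ := Finset.mem_filter.1 hg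
    set Z := Finset.univ.filter fun x => IsBadSample A S η (fun i => b i - g) x with hZ
    have hpt (a : G) : |shiftMean A S (x + g - a) - B (x - a)| ≤
        η + if x + g - a ∈ Z then 1 else 0 := by
      split_ifs with hz
      · obtain ⟨h0, h1⟩ := shiftMean_mem_Icc A S (x + g - a)
        obtain ⟨h2, h3⟩ := hB (x - a)
        rw [abs_le]
        constructor <;> linarith
      · have hz' : ¬ IsBadSample A S η (fun i => b i - g) (x + g - a) := by
          simpa [hZ] using hz
        rw [IsBadSample, not_lt, Finset.sum_sub_distrib] at hz'
        have e : ∀ i, x + g - a + (b i - g) = x - a + b i := fun i => by abel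
        simp only [e, Finset.sum_const, Finset.card_univ, Fintype.card_fin, nsmul_eq_mul] at hz'
        have : shiftMean A S (x + g - a) - B (x - a) =
            -(((∑ i, if x - a + b i ∈ S then (1 : ℝ) else 0) -
              k * shiftMean A S (x + g - a)) / k) := by
          simp only [B]
          field_simp
          ring
        rw [this, abs_neg, abs_div, abs_of_pos hk', add_zero, div_le_iff₀ hk']
        linarith
    have hcount : ∑ a ∈ A, (if x + g - a ∈ Z then (1 : ℝ) else 0) ≤ Z.card := by
      calc ∑ a ∈ A, (if x + g - a ∈ Z then (1 : ℝ) else 0)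
          ≤ ∑ a, (if x + g - a ∈ Z then (1 : ℝ) else 0) :=
            Finset.sum_le_sum_of_subset_of_nonneg (Finset.subset_univ _) fun a _ _ => by
              split_ifs <;> norm_num
        _ = ∑ a, (if a ∈ Z then (1 : ℝ) else 0) :=
            Equiv.sum_comp (Equiv.subLeft (x + g)) fun a => if a ∈ Z then (1 : ℝ) else 0
        _ = Z.card := by simp
    rw [diffMean, ← sub_div, ← Finset.sum_sub_distrib, abs_div, abs_of_pos hc, div_le_iff₀ hc]
    calc |∑ a ∈ A, (shiftMean A S (x + g - a) - B (x - a))|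
        ≤ ∑ a ∈ A, (η + if x + g - a ∈ Z then 1 else 0) :=
          (Finset.abs_sum_le_sum_abs _ _).trans (Finset.sum_le_sum fun a _ => hpt a)
      _ ≤ A.card * η + Z.card := by
          rw [Finset.sum_add_distrib]
          simpa using hcount
      _ ≤ 2 * η * A.card := by linarith

end almost_periodicity

section iterated_averages

variable {G : Type*} [AddCommGroup G]

/-- The average of `h` over the translates of `x` by differences of elements of `T`. -/
noncomputable def diffAvg (T : Finset G) (h : G → ℝ) (x : G) : ℝ :=
  (∑ g ∈ T, ∑ g' ∈ T, h (x + g - g')) / (T.card : ℝ) ^ 2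

theorem abs_diffAvg_sub_le {T : Finset G} (hT : T.Nonempty) {u : G → ℝ} {y c : ℝ} {x : G}
    (h : ∀ g ∈ T, ∀ g' ∈ T, |u (x + g - g') - y| ≤ c) : |diffAvg T u x - y| ≤ c := by
  have hc : (0 : ℝ) < T.card := by exact_mod_cast hT.card_pos
  have : diffAvg T u x - y = (∑ g ∈ T, ∑ g' ∈ T, (u (x + g - g') - y)) / (T.card : ℝ) ^ 2 := by
    simp only [diffAvg, Finset.sum_sub_distrib, Finset.sum_const, nsmul_eq_mul]
    field_simp
  rw [this, abs_div, abs_of_pos (show 0 < (T.card : ℝ) ^ 2 by positivity),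
    div_le_iff₀ (by positivity)]
  calc _ ≤ ∑ g ∈ T, ∑ g' ∈ T, |u (x + g - g') - y| :=
        (Finset.abs_sum_le_sum_abs _ _).trans
          (Finset.sum_le_sum fun _ _ => Finset.abs_sum_le_sum_abs _ _)
    _ ≤ ∑ g ∈ T, ∑ g' ∈ T, c :=
        Finset.sum_le_sum fun g hg => Finset.sum_le_sum fun g' hg' => h g hg g' hg'
    _ = _ := by simp; ring

theorem abs_iterate_diffAvg_sub_le {T : Finset G} (hT : T.Nonempty) {h H : G → ℝ} {ρ : ℝ}
    (hH : ∀ g ∈ T, ∀ x, |h (x + g) - H x| ≤ ρ) (j : ℕ) (x : G) :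
    |(diffAvg T)^[j] h x - h x| ≤ 2 * j * ρ := by
  induction j generalizing x with
  | zero => simp
  | succ j ih =>
    rw [Function.iterate_succ_apply']
    refine abs_diffAvg_sub_le hT fun g hg g' hg' => ?_
    have h1 := abs_le.1 (ih (x + g - g'))
    have h2 := abs_le.1 (hH g hg (x - g'))
    have h3 := abs_le.1 (hH g' hg' (x - g'))
    rw [sub_add_cancel] at h3
    rw [sub_add_eq_add_sub] at h2
    push_cast
    rw [abs_le]
    constructor <;> linarith

end iterated_averages

section fourier

variable {G : Type*} [AddCommGroup G]

theorem diffMean_eq_diffAvg (A S : Finset G) :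
    diffMean A S = diffAvg A fun x => if x ∈ S then 1 else 0 := by
  funext x
  simp only [diffMean, diffAvg, shiftMean, ← Finset.sum_div, div_div, sq]
  rw [Finset.sum_comm]
  simp_rw [sub_add_eq_add_sub]

/-- The exponential sum of the character `χ` over `A`. -/
noncomputable def expSum (χ : AddChar G ℂ) (A : Finset G) : ℂ := ∑ a ∈ A, χ a

variable [Fintype G]

theorem conj_expSum (χ : AddChar G ℂ) (A : Finset G) :
    (starRingEnd ℂ) (expSum χ A) = ∑ a ∈ A, χ (-a) := by
  simp [expSum, AddChar.map_neg_eq_conj]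

theorem norm_expSum_sq (χ : AddChar G ℂ) (A : Finset G) :
    ((‖expSum χ A‖ ^ 2 : ℝ) : ℂ) = ∑ a ∈ A, ∑ b ∈ A, χ (a - b) := by
  push_cast
  rw [← Complex.mul_conj', conj_expSum, expSum, Finset.sum_mul_sum]
  simp_rw [← AddChar.map_add_eq_mul, sub_eq_add_neg]

theorem norm_expSum_le (χ : AddChar G ℂ) (A : Finset G) : ‖expSum χ A‖ ≤ A.card := by
  refine (norm_sum_le _ _).trans ?_
  simp [AddChar.norm_apply]

/-- The proportion `|E_{t ∈ T} χ(t)|²`. -/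
noncomputable def multiplier (T : Finset G) (χ : AddChar G ℂ) : ℝ :=
  (‖expSum χ T‖ / T.card) ^ 2

variable {ι : Type*} [Fintype ι] {χ : ι → AddChar G ℂ}

theorem diffAvg_expansion (T : Finset G) {h : G → ℝ} {c : ι → ℂ}
    (hc : ∀ x, (h x : ℂ) = ∑ i, c i * χ i x) (x : G) :
    (diffAvg T h x : ℂ) = ∑ i, c i * multiplier T (χ i) * χ i x := by
  have e (i : ι) : c i * multiplier T (χ i) * χ i x =
      (∑ g ∈ T, ∑ g' ∈ T, c i * χ i (x + g - g')) / (T.card : ℂ) ^ 2 := by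
    have (g g' : G) : c i * χ i (x + g - g') = c i * χ i x * χ i (g - g') := by
      rw [add_sub_assoc, AddChar.map_add_eq_mul, mul_assoc]
    simp_rw [this, ← Finset.mul_sum, ← norm_expSum_sq, multiplier, div_pow]
    push_cast
    ring
  simp_rw [e, ← Finset.sum_div]
  rw [diffAvg]
  push_cast
  simp_rw [hc]
  congr 1
  rw [Finset.sum_comm (s := Finset.univ)]
  refine Finset.sum_congr rfl fun g _ => ?_
  rw [Finset.sum_comm (s := Finset.univ)]

theorem iterate_diffAvg_expansion (T : Finset G) {h : G → ℝ} {c : ι → ℂ}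
    (hc : ∀ x, (h x : ℂ) = ∑ i, c i * χ i x) (j : ℕ) (x : G) :
    (((diffAvg T)^[j] h x : ℝ) : ℂ) = ∑ i, c i * (multiplier T (χ i) : ℂ) ^ j * χ i x := by
  induction j generalizing x with
  | zero => simp [hc]
  | succ j ih =>
    rw [Function.iterate_succ_apply', diffAvg_expansion T ih]
    simp_rw [pow_succ, mul_assoc]

theorem sum_norm_expSum_sq
    (hχ : ∀ x, ∑ i, χ i x = if x = 0 then (Fintype.card G : ℂ) else 0)
    (A : Finset G) :
    ∑ i, ‖expSum (χ i) A‖ ^ 2 = Fintype.card G * A.card := by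
  have : ((∑ i, ‖expSum (χ i) A‖ ^ 2 : ℝ) : ℂ) = Fintype.card G * A.card := by
    rw [Complex.ofReal_sum]
    simp_rw [norm_expSum_sq]
    rw [Finset.sum_comm]
    have (a : G) : ∑ i, ∑ b ∈ A, χ i (a - b) =
        ∑ b ∈ A, if a = b then (Fintype.card G : ℂ) else 0 := by
      rw [Finset.sum_comm]
      simp [hχ, sub_eq_zero]
    simp [this, mul_comm]
  exact_mod_cast this

theorem indicator_expansion
    (hχ : ∀ x, ∑ i, χ i x = if x = 0 then (Fintype.card G : ℂ) else 0)
    (S : Finset G) (x : G) :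
    (((if x ∈ S then 1 else 0 : ℝ)) : ℂ) =
      ∑ i, (starRingEnd ℂ) (expSum (χ i) S) / Fintype.card G * χ i x := by
  have hN : (Fintype.card G : ℂ) ≠ 0 := by exact_mod_cast Fintype.card_ne_zero
  have e (i : ι) : (starRingEnd ℂ) (expSum (χ i) S) / Fintype.card G * χ i x =
      (∑ s ∈ S, χ i (x - s)) / Fintype.card G := by
    rw [conj_expSum, div_mul_eq_mul_div, Finset.sum_mul]
    simp_rw [← AddChar.map_add_eq_mul, neg_add_eq_sub]
  simp_rw [e, ← Finset.sum_div]
  rw [Finset.sum_comm]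
  simp only [hχ, sub_eq_zero, Finset.sum_ite_eq]
  split_ifs <;> simp [hN]

/-- Iterated averaging of `diffMean A S` over differences of `T` is nearly invariant under the
common kernel of the large spectrum of `T`. -/
theorem abs_iterate_diffAvg_diffMean_sub_le
    (hχ : ∀ x, ∑ i, χ i x = if x = 0 then (Fintype.card G : ℂ) else 0)
    {A T : Finset G} (hA : A.Nonempty) (S : Finset G) (j : ℕ) {v : G}
    (hv : ∀ i, 1 / 4 ≤ multiplier T (χ i) → χ i v = 1) :
    |(diffAvg T)^[j] (diffMean A S) v - (diffAvg T)^[j] (diffMean A S) 0| ≤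
      2 * (1 / 4) ^ j * (Fintype.card G / A.card) := by
  have hN : (0 : ℝ) < Fintype.card G := by exact_mod_cast Fintype.card_pos
  have hcA : (0 : ℝ) < A.card := by exact_mod_cast hA.card_pos
  have hexp := fun x => iterate_diffAvg_expansion T
    (diffAvg_expansion A (indicator_expansion hχ S)) j x
  rw [← diffMean_eq_diffAvg] at hexp
  have hcoef (i : ι) : ‖(starRingEnd ℂ) (expSum (χ i) S) / (Fintype.card G : ℂ) *
      (multiplier A (χ i) : ℂ)‖ ≤ multiplier A (χ i) := by
    have hm : 0 ≤ multiplier A (χ i) := sq_nonneg _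
    rw [norm_mul, norm_div, RCLike.norm_conj, Complex.norm_natCast, Complex.norm_real,
      Real.norm_of_nonneg hm]
    refine mul_le_of_le_one_left hm (div_le_one_of_le₀ ?_ hN.le)
    exact (norm_expSum_le _ _).trans (by exact_mod_cast Finset.card_le_univ S)
  rw [← Real.norm_eq_abs, ← Complex.norm_real]
  push_cast
  rw [hexp, hexp, ← Finset.sum_sub_distrib]
  calc _ ≤ ∑ i, multiplier A (χ i) * (2 * (1 / 4) ^ j) := by
        refine norm_sum_le_of_le _ fun i _ => ?_
        have hT : 0 ≤ multiplier T (χ i) := sq_nonneg _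
        rw [← mul_sub, mul_assoc _ _ (_ - _), norm_mul]
        refine mul_le_mul (hcoef i) ?_ (norm_nonneg _) (sq_nonneg _)
        rw [AddChar.map_zero_eq_one]
        by_cases h : 1 / 4 ≤ multiplier T (χ i)
        · rw [hv i h, sub_self, mul_zero, norm_zero]
          positivity
        · rw [norm_mul, norm_pow, Complex.norm_real, Real.norm_of_nonneg hT, mul_comm]
          push Not at h
          refine mul_le_mul ?_ (pow_le_pow_left₀ hT h.le j) (by positivity) (by norm_num)
          refine (norm_sub_le _ _).trans ?_
          rw [AddChar.norm_apply, norm_one]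
          norm_num
    _ = _ := by
        simp_rw [← Finset.sum_mul, multiplier, div_pow, ← Finset.sum_div, sum_norm_expSum_sq hχ]
        field_simp

end fourier

section spectrum

theorem card_mul_sum_comp_of_surjective {G H : Type*} [AddCommGroup G] [Fintype G]
    [AddCommGroup H] [Fintype H] (φ : G →+ H) (hφ : Function.Surjective φ) (f : H → ℝ) :
    Fintype.card H * ∑ x, f (φ x) = Fintype.card G * ∑ y, f y := by
  have h1 (y : H) : ∑ x, f (φ x) = ∑ x, f (φ x + y) := by
    obtain ⟨g, rfl⟩ := hφ y
    rw [← Equiv.sum_comp (Equiv.addRight g)]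
    simp
  have h2 : ∑ y : H, ∑ x, f (φ x) = ∑ x : G, ∑ y, f y := by
    rw [Finset.sum_congr rfl fun y _ => h1 y, Finset.sum_comm]
    exact Finset.sum_congr rfl fun x _ => Equiv.sum_comp (Equiv.addLeft (φ x)) f
  simpa using h2

variable {F : Type*} [Field F] {n : ℕ}

/-- The character `x ↦ ψ (ξ ⬝ᵥ x)`. -/
noncomputable def dotChar (ψ : AddChar F ℂ) (ξ : Fin n → F) : AddChar (Fin n → F) ℂ :=
  ψ.compAddMonoidHom (AddMonoidHom.mk' (fun x => ξ ⬝ᵥ x) (dotProduct_add ξ))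

@[simp] theorem dotChar_apply (ψ : AddChar F ℂ) (ξ x : Fin n → F) :
    dotChar ψ ξ x = ψ (ξ ⬝ᵥ x) := rfl

variable [Fintype F] {ψ : AddChar F ℂ}

theorem sum_dotChar (hψ : ψ.IsPrimitive) (x : Fin n → F) :
    ∑ ξ, dotChar ψ ξ x = if x = 0 then (Fintype.card (Fin n → F) : ℂ) else 0 := by
  split_ifs with hx
  · simp [hx]
  · obtain ⟨i, hi⟩ := Function.ne_iff.1 hx
    obtain ⟨a, ha⟩ := AddChar.ne_one_iff.1 (hψ hi)
    have hne : dotChar ψ x ≠ 1 := AddChar.ne_one_iff.2 ⟨Pi.single i a, by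
      simpa [AddChar.mulShift_apply] using ha⟩
    rw [← AddChar.sum_eq_zero_of_ne_one hne]
    simp [dotProduct_comm]

theorem card_le_of_linearIndependent_of_large_spectrum (hψ : ψ.IsPrimitive)
    {T : Finset (Fin n → F)} (hT : T.Nonempty) {κ : Type*} [Fintype κ] {ξ : κ → Fin n → F}
    (hξ : LinearIndependent F ξ) (hspec : ∀ i, 1 / 4 ≤ multiplier T (dotChar ψ (ξ i))) :
    (Fintype.card κ : ℝ) ≤ 8 * Real.log (Fintype.card (Fin n → F) / T.card) := by
  have hcT : (0 : ℝ) < T.card := by exact_mod_cast hT.card_pos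
  have hN : (0 : ℝ) < Fintype.card (Fin n → F) := by exact_mod_cast Fintype.card_pos
  set m : ℝ := (Fintype.card κ : ℝ) with hm
  let z : κ → ℂ := fun i => expSum (dotChar ψ (ξ i)) T
  let u : κ → ℂ := fun i => (starRingEnd ℂ) (z i) / ‖z i‖
  have hz (i : κ) : (T.card : ℝ) / 2 ≤ ‖z i‖ := by
    have h := hspec i
    rw [multiplier, show (1 : ℝ) / 4 = (1 / 2) ^ 2 by norm_num] at h
    have := (pow_le_pow_iff_left₀ (by norm_num) (by positivity) two_ne_zero).1 h
    rw [le_div_iff₀ hcT] at this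
    change _ ≤ ‖expSum (dotChar ψ (ξ i)) T‖
    linarith
  have hz0 (i : κ) : 0 < ‖z i‖ := lt_of_lt_of_le (by positivity) (hz i)
  have hu (i : κ) : ‖u i‖ = 1 := by
    simp only [u, norm_div, RCLike.norm_conj, Complex.norm_real, norm_norm]
    exact div_self (hz0 i).ne'
  have huz (i : κ) : (u i * z i).re = ‖z i‖ := by
    have : u i * z i = ((‖z i‖ : ℝ) : ℂ) := by
      have h0 : ((‖z i‖ : ℝ) : ℂ) ≠ 0 := by exact_mod_cast (hz0 i).ne'
      simp only [u]
      rw [div_mul_eq_mul_div, mul_comm, Complex.mul_conj', sq, mul_div_assoc, div_self h0, mul_one]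
    rw [this, Complex.ofReal_re]
  let f : κ → F → ℝ := fun i w => (u i * ψ w).re
  have hf (i : κ) (w : F) : |f i w| ≤ 1 := by
    refine (Complex.abs_re_le_norm _).trans ?_
    rw [norm_mul, hu, AddChar.norm_apply, mul_one]
  have hf0 (i : κ) : ∑ w, f i w = 0 := by
    have h1 := AddChar.sum_mulShift (1 : F) hψ
    simp only [mul_one, one_ne_zero, if_false] at h1
    rw [← Complex.re_sum, ← Finset.mul_sum, h1]
    simp
  let M : (Fin n → F) →ₗ[F] (κ → F) := (Matrix.of ξ).mulVecLin
  have hM : Function.Surjective M := by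
    rw [← LinearMap.range_eq_top]
    apply Submodule.eq_top_of_finrank_eq
    rw [Module.finrank_fintype_fun_eq_card]
    exact LinearIndependent.rank_matrix (M := Matrix.of ξ) hξ
  let y : (Fin n → F) → ℝ := fun x => ∑ i, f i (M x i)
  have hy : m * T.card / 2 ≤ ∑ x ∈ T, y x := by
    have h1 : ∑ x ∈ T, y x = ∑ i, ‖z i‖ := by
      rw [Finset.sum_comm]
      refine Finset.sum_congr rfl fun i _ => ?_
      rw [← huz, ← Complex.re_sum, ← Finset.mul_sum]
      rfl
    rw [h1]
    calc m * T.card / 2 = ∑ i : κ, (T.card : ℝ) / 2 := by simp [hm]; ring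
      _ ≤ _ := Finset.sum_le_sum fun i _ => hz i
  have hlow : Real.exp (m / 4) * T.card ≤ ∑ x ∈ T, Real.exp (1 / 2 * y x) := by
    calc Real.exp (m / 4) * T.card
        ≤ Real.exp (m / 4) * ∑ x ∈ T, (1 + (1 / 2 * y x - m / 4)) := by
          gcongr
          rw [Finset.sum_add_distrib, Finset.sum_sub_distrib, ← Finset.mul_sum]
          simp only [Finset.sum_const, nsmul_eq_mul]
          linarith
      _ ≤ _ := by
          rw [Finset.mul_sum]
          refine Finset.sum_le_sum fun x _ => ?_
          calc _ ≤ Real.exp (m / 4) * Real.exp (1 / 2 * y x - m / 4) := by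
                gcongr
                rw [add_comm]
                exact Real.add_one_le_exp _
            _ = _ := by rw [← Real.exp_add]; ring_nf
  have hup : ∑ x, Real.exp (1 / 2 * y x) ≤
      Fintype.card (Fin n → F) * Real.exp (m / 8) := by
    have h1 := card_mul_sum_comp_of_surjective M.toAddMonoidHom hM
      fun w => Real.exp (1 / 2 * ∑ i, f i (w i))
    have h2 : ∑ w : κ → F, Real.exp (1 / 2 * ∑ i, f i (w i)) ≤
        Fintype.card (κ → F) * Real.exp (m / 8) := by
      calc _ = ∏ i, ∑ w, Real.exp (1 / 2 * f i w) := by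
            rw [Fintype.prod_sum]
            simp_rw [Finset.mul_sum, Real.exp_sum]
        _ ≤ ∏ i : κ, (Fintype.card F * Real.exp ((1 / 2) ^ 2 / 2)) := by
            refine Finset.prod_le_prod (fun i _ => Finset.sum_nonneg fun _ _ => (Real.exp_pos _).le)
              fun i _ => sum_exp_mul_le (hf i) (hf0 i) _
        _ = _ := by
            rw [Finset.prod_const, mul_pow, ← Real.exp_nat_mul, Finset.card_univ]
            simp only [Fintype.card_fun]
            push_cast
            congr 2
            rw [hm]
            ring
    have hK : (0 : ℝ) < Fintype.card (κ → F) := by exact_mod_cast Fintype.card_pos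
    refine le_of_mul_le_mul_left ?_ hK
    calc _ = _ := h1
      _ ≤ Fintype.card (Fin n → F) * (Fintype.card (κ → F) * Real.exp (m / 8)) := by gcongr
      _ = _ := by ring
  have hsub : ∑ x ∈ T, Real.exp (1 / 2 * y x) ≤ ∑ x, Real.exp (1 / 2 * y x) :=
    Finset.sum_le_sum_of_subset_of_nonneg (Finset.subset_univ _) fun _ _ _ => (Real.exp_pos _).le
  have hfin : Real.exp (m / 8) ≤ Fintype.card (Fin n → F) / T.card := by
    rw [le_div_iff₀ hcT]
    have h8 : Real.exp (m / 4) = Real.exp (m / 8) * Real.exp (m / 8) := by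
      rw [← Real.exp_add]; ring_nf
    rw [h8] at hlow
    refine le_of_mul_le_mul_left ?_ (Real.exp_pos (m / 8))
    linarith
  have := (Real.le_log_iff_exp_le (by positivity)).2 hfin
  linarith

/-- Chang's lemma: the large spectrum of `T` is annihilated by a subspace of small codimension. -/
theorem exists_submodule_annihilating_large_spectrum (hψ : ψ.IsPrimitive)
    {T : Finset (Fin n → F)} (hT : T.Nonempty) :
    ∃ (W : Submodule F (Fin n → F)) (m : ℕ), n ≤ Module.finrank F W + m ∧
      (m : ℝ) ≤ 8 * Real.log (Fintype.card (Fin n → F) / T.card) ∧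
      ∀ v ∈ W, ∀ ξ, 1 / 4 ≤ multiplier T (dotChar ψ ξ) → dotChar ψ ξ v = 1 := by
  obtain ⟨b, hb, hspan, hli⟩ :=
    exists_linearIndependent F {ξ : Fin n → F | 1 / 4 ≤ multiplier T (dotChar ψ ξ)}
  refine ⟨(Matrix.of fun i : b => (i : Fin n → F)).mulVecLin.ker, Fintype.card b, ?_,
    card_le_of_linearIndependent_of_large_spectrum hψ hT hli fun i => hb i.2, ?_⟩
  · have h1 := LinearMap.finrank_range_add_finrank_ker
      (Matrix.of fun i : b => (i : Fin n → F)).mulVecLin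
    have h2 := Submodule.finrank_le (Matrix.of fun i : b => (i : Fin n → F)).mulVecLin.range
    simp only [Module.finrank_fintype_fun_eq_card, Fintype.card_fin] at h1 h2
    omega
  · intro v hv ξ hξ
    have hmem : ξ ∈ Submodule.span F b := by
      rw [hspan]
      exact Submodule.subset_span hξ
    have h0 : ξ ⬝ᵥ v = 0 := by
      clear hξ
      induction hmem using Submodule.span_induction with
      | mem x hx => exact congrFun (LinearMap.mem_ker.1 hv) ⟨x, hx⟩
      | zero => simp
      | add x y _ _ hx hy => rw [add_dotProduct, hx, hy, add_zero]
      | smul a x _ hx => rw [smul_dotProduct, hx, smul_zero]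
    rw [dotChar_apply, h0, AddChar.map_zero_eq_one]

end spectrum

section smoothing

theorem sampling_error_le {D : ℕ} {ε η : ℝ} {k : ℕ} (hε : 0 < ε) (hε' : ε ≤ 1 / 4)
    (hD : 16 / ε ^ 2 ≤ D) (hη : η = ε / (64 * D)) (hk : 10 * D / η ^ 2 ≤ k) :
    4 * Real.exp (-(k * η ^ 2 / 2)) * 2 ^ D ≤ η := by
  have hD1 : 1 / ε ≤ D := by
    refine le_trans ?_ hD
    rw [div_le_div_iff₀ hε (by positivity)]
    nlinarith
  have hD256 : (256 : ℝ) ≤ D := by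
    refine le_trans ?_ hD
    rw [le_div_iff₀ (by positivity)]
    nlinarith
  have hD0 : (0 : ℝ) < D := by linarith
  have hη0 : 0 < η := by rw [hη]; positivity
  have hk5 : 5 * (D : ℝ) ≤ k * η ^ 2 / 2 := by
    rw [div_le_iff₀ (by positivity)] at hk
    linarith
  have hexp : Real.exp (-(k * η ^ 2 / 2)) ≤ Real.exp (-(5 * D)) := by
    gcongr
  have he : (D : ℝ) ≤ Real.exp D := by linarith [Real.add_one_le_exp (D : ℝ)]
  have h2 : (2 : ℝ) ^ D ≤ Real.exp D := by
    rw [← mul_one (D : ℝ), Real.exp_nat_mul]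
    gcongr
    linarith [Real.add_one_le_exp (1 : ℝ)]
  have h5 : Real.exp (-(5 * (D : ℝ))) * Real.exp D ^ 5 = 1 := by
    rw [← Real.exp_nat_mul, ← Real.exp_add]
    simp
  have hεD : 1 ≤ ε * D := by
    rw [div_le_iff₀ hε] at hD1
    linarith
  have hmain : 256 * D * 2 ^ D ≤ ε * Real.exp D ^ 5 := by
    set E := Real.exp (D : ℝ)
    have hE : 0 < E := Real.exp_pos _
    calc 256 * D * (2 : ℝ) ^ D ≤ E * E * E := by
          gcongr
          linarith
      _ ≤ (ε * D) * (E * E * E) := le_mul_of_one_le_left (by positivity) hεD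
      _ ≤ (ε * E) * (E * E * E) := by gcongr
      _ ≤ (ε * E) * (E * E * E) * E := le_mul_of_one_le_right (by positivity) (by linarith)
      _ = _ := by ring
  calc 4 * Real.exp (-(k * η ^ 2 / 2)) * 2 ^ D ≤ 4 * Real.exp (-(5 * D)) * 2 ^ D := by gcongr
    _ = Real.exp (-(5 * D)) * (256 * D * 2 ^ D) / (64 * D) := by field_simp; norm_num
    _ ≤ Real.exp (-(5 * D)) * (ε * Real.exp D ^ 5) / (64 * D) := by gcongr
    _ = η * (Real.exp (-(5 * D)) * Real.exp D ^ 5) := by rw [hη]; ring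
    _ = η := by rw [h5, mul_one]

/-- For a set `A` of density at least `2 ^ (-D)`, the function `diffMean A S` hardly decreases
from `0` to a point of a suitable subspace of codimension polynomial in `D`. -/
theorem exists_submodule_diffMean_ge {F : Type*} [Field F] [Fintype F] {n : ℕ}
    {A : Finset (Fin n → F)} (hA : A.Nonempty) (S : Finset (Fin n → F)) {D : ℕ} {ε : ℝ}
    (hε : 0 < ε) (hε' : ε ≤ 1 / 4) (hD : 16 / ε ^ 2 ≤ D)
    (hAD : (Fintype.card (Fin n → F) : ℝ) ≤ 2 ^ D * A.card) :
    ∃ (W : Submodule F (Fin n → F)) (m : ℕ), n ≤ Module.finrank F W + m ∧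
      (m : ℝ) ≤ D ^ 4 / ε ^ 12 ∧ ∀ v ∈ W, diffMean A S 0 - ε / 4 ≤ diffMean A S v := by
  have hN : (0 : ℝ) < Fintype.card (Fin n → F) := by exact_mod_cast Fintype.card_pos
  have hcA : (0 : ℝ) < A.card := by exact_mod_cast hA.card_pos
  have hD256 : (256 : ℝ) ≤ D := by
    refine le_trans ?_ hD
    rw [le_div_iff₀ (by positivity)]
    nlinarith
  have hD0 : (0 : ℝ) < D := by linarith
  obtain ⟨η, hη⟩ : ∃ η, η = ε / (64 * D) := ⟨_, rfl⟩
  have hη0 : 0 < η := by rw [hη]; positivity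
  have hη1 : η ≤ 1 := by
    rw [hη]
    exact div_le_one_of_le₀ (by linarith) (by positivity)
  obtain ⟨k, hk⟩ : ∃ k : ℕ, k = ⌈10 * D / η ^ 2⌉₊ := ⟨_, rfl⟩
  have hk1 : 10 * D / η ^ 2 ≤ k := by rw [hk]; exact Nat.le_ceil _
  have hDη : 1 ≤ D / η ^ 2 := by
    rw [le_div_iff₀ (by positivity)]
    nlinarith
  have hk2 : (k : ℝ) ≤ 11 * D / η ^ 2 := by
    have := (Nat.ceil_lt_add_one (show 0 ≤ 10 * D / η ^ 2 by positivity)).le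
    rw [← hk] at this
    refine this.trans ?_
    rw [mul_div_assoc, mul_div_assoc]
    linarith
  have hk0' : (1 : ℝ) ≤ k := by
    refine le_trans ?_ hk1
    rw [mul_div_assoc]
    linarith
  have hk0 : 0 < k := by exact_mod_cast hk0'
  have hsample : 4 * Real.exp (-(k * η ^ 2 / 2)) * Fintype.card (Fin n → F) ≤ η * A.card := by
    have h := sampling_error_le hε hε' hD hη hk1
    calc _ ≤ 4 * Real.exp (-(k * η ^ 2 / 2)) * (2 ^ D * A.card) := by gcongr
      _ = 4 * Real.exp (-(k * η ^ 2 / 2)) * 2 ^ D * A.card := by ring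
      _ ≤ _ := by gcongr
  obtain ⟨T, H, hTcard, hTH⟩ := exists_almost_periods hA S hk0 hη0 hsample
  have hcT : (0 : ℝ) < T.card := lt_of_lt_of_le (by positivity) hTcard
  have hT : T.Nonempty := Finset.card_pos.1 (by exact_mod_cast hcT)
  have hψ := AddChar.FiniteField.primitiveChar_to_Complex_isPrimitive F
  obtain ⟨W, m, hWm, hm, hW⟩ := exists_submodule_annihilating_large_spectrum hψ hT
  refine ⟨W, m, hWm, hm.trans ?_, fun v hv => ?_⟩
  · have h1 : Fintype.card (Fin n → F) / (T.card : ℝ) ≤ 2 ^ (D * k + 1) := by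
      rw [div_le_iff₀ hcT]
      have h2 : (1 : ℝ) ≤ 2 ^ D * (A.card / Fintype.card (Fin n → F)) := by
        rw [← mul_div_assoc, le_div_iff₀ hN]
        linarith
      have h3 := one_le_pow₀ h2 (n := k)
      rw [mul_pow, ← pow_mul] at h3
      rw [pow_succ]
      calc (Fintype.card (Fin n → F) : ℝ) = 1 * Fintype.card (Fin n → F) := by ring
        _ ≤ 2 ^ (D * k) * (A.card / Fintype.card (Fin n → F)) ^ k * Fintype.card (Fin n → F) := by
          gcongr
        _ = 2 ^ (D * k) * 2 *
          ((A.card / Fintype.card (Fin n → F)) ^ k / 2 * Fintype.card (Fin n → F)) := by ring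
        _ ≤ _ := by gcongr
    have h2 : Real.log (Fintype.card (Fin n → F) / (T.card : ℝ)) ≤ D * k + 1 := by
      refine (Real.log_le_log (by positivity) h1).trans ?_
      rw [Real.log_pow]
      push_cast
      refine mul_le_of_le_one_right (by positivity) ?_
      linarith [Real.log_two_lt_d9]
    have h3 : (1 : ℝ) ≤ D * k := by nlinarith
    have h4 : (11 * D / η ^ 2 : ℝ) = 11 * 4096 * D ^ 3 / ε ^ 2 := by
      rw [hη]
      field_simp
      norm_num
    have h5 : 4 ^ 10 ≤ 1 / ε ^ 10 := by
      rw [le_div_iff₀ (by positivity), ← mul_pow]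
      exact pow_le_one₀ (by positivity) (by linarith)
    calc _ ≤ 8 * ((D : ℝ) * k + 1) := by gcongr
      _ ≤ 16 * (D * (11 * D / η ^ 2)) := by
          have : (D : ℝ) * k ≤ D * (11 * D / η ^ 2) := by gcongr
          linarith
      _ = 720896 * (D ^ 4 / ε ^ 2) := by rw [h4]; ring
      _ ≤ 4 ^ 10 * (D ^ 4 / ε ^ 2) := by gcongr; norm_num
      _ ≤ 1 / ε ^ 10 * (D ^ 4 / ε ^ 2) := by gcongr
      _ = _ := by field_simp
  · have h1 := abs_le.1 (abs_iterate_diffAvg_sub_le hT hTH D v)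
    have h2 := abs_le.1 (abs_iterate_diffAvg_sub_le hT hTH D 0)
    have h3 := abs_le.1 (abs_iterate_diffAvg_diffMean_sub_le
      (fun x => by convert sum_dotChar hψ x) hA S D (hW v hv))
    have h4 : 2 * (D : ℝ) * (2 * η) = ε / 16 := by
      rw [hη]
      field_simp
      norm_num
    have h5 : 2 * (1 / 4) ^ D * (Fintype.card (Fin n → F) / A.card : ℝ) ≤ ε / 8 := by
      have h6 : (D : ℝ) ≤ 2 ^ D := by exact_mod_cast D.lt_two_pow_self.le
      calc _ ≤ 2 * (1 / 4) ^ D * (2 : ℝ) ^ D := by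
            gcongr
            rwa [div_le_iff₀ hcA]
        _ = 2 / 2 ^ D := by
            rw [mul_assoc, ← mul_pow, show (1 / 4 * 2 : ℝ) = 2⁻¹ by norm_num, inv_pow,
              div_eq_mul_inv]
        _ ≤ 2 / (16 / ε ^ 2) := by gcongr; exact hD.trans h6
        _ = ε / 8 * ε := by field_simp; norm_num
        _ ≤ ε / 8 := mul_le_of_le_one_right (by positivity) (by linarith)
    rw [h4] at h1 h2
    linarith [h1.1, h1.2, h2.1, h2.2, h3.1, h3.2]

end smoothing

section moments

theorem choose_mul_sum_pow_le {ι : Type*} [Fintype ι] {w : ι → ℝ}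
    (hw : ∀ i, 0 ≤ ∑ t, w t ^ i) {m K : ℕ} (hK : K ≤ m) :
    m.choose K * ∑ t, w t ^ K ≤ ∑ t, (1 + w t) ^ m := by
  have h : ∑ t, (1 + w t) ^ m = ∑ i ∈ Finset.range (m + 1), m.choose i * ∑ t, w t ^ i := by
    simp_rw [add_comm (1 : ℝ), add_pow, one_pow, mul_one, Finset.mul_sum]
    rw [Finset.sum_comm]
    simp_rw [mul_comm]
  rw [h]
  exact Finset.single_le_sum (f := fun i => (m.choose i : ℝ) * ∑ t, w t ^ i)
    (fun i _ => mul_nonneg (by positivity) (hw i)) (Finset.mem_range.2 (by omega))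

theorem inv_pow_le_choose {m K : ℕ} {ε : ℝ} (hε : 0 < ε) (hε' : ε ≤ 1) (hK : 0 < K)
    (hm : 2 * K / ε ≤ m) : (1 / ε) ^ K ≤ m.choose K := by
  have hK0 : (0 : ℝ) < K := by exact_mod_cast hK
  have hm2 : (2 * K : ℝ) ≤ m := by
    refine le_trans ?_ hm
    exact le_div_self (by positivity) hε hε'
  have hmK : 2 * K ≤ m := by exact_mod_cast hm2
  refine le_trans ?_ (Nat.pow_le_choose K m)
  have hf : ((K.factorial : ℕ) : ℝ) ≤ (K : ℝ) ^ K := by exact_mod_cast Nat.factorial_le_pow K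
  have hs : (m / 2 : ℝ) ≤ ((m + 1 - K : ℕ) : ℝ) := by
    rw [Nat.cast_sub (by omega)]
    push_cast
    linarith
  calc (1 / ε) ^ K ≤ (m / 2 / K : ℝ) ^ K := by
        refine pow_le_pow_left₀ (by positivity) ?_ K
        rw [le_div_iff₀ hK0, le_div_iff₀ two_pos]
        calc 1 / ε * K * 2 = 2 * K / ε := by ring
          _ ≤ m := hm
    _ = (m / 2 : ℝ) ^ K / (K : ℝ) ^ K := by rw [div_pow]
    _ ≤ _ := by gcongr

/-- If all power sums of `w` are nonnegative and the `K`-th moment of `w` is large, then some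
moment of `1 + w` of order comparable to `K / ε ^ 2` dominates `(1 + 4 * ε) ^ p`. -/
theorem exists_large_moment {ι : Type*} [Fintype ι] [Nonempty ι] {w : ι → ℝ}
    (hw : ∀ i, 0 ≤ ∑ t, w t ^ i) (hw1 : ∀ t, 0 ≤ 1 + w t) {K : ℕ} (hK : 2 ≤ K) {ε : ℝ}
    (hε : 0 < ε) (hε' : ε ≤ 1 / 4)
    (h : (Real.exp 13 * ε) ^ K * Fintype.card ι < ∑ t, w t ^ K) :
    ∃ p : ℕ, 16 / ε ^ 2 ≤ p ∧ p ≤ 15 * K / ε ^ 2 ∧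
      Fintype.card ι < ∑ t, (1 + w t) ^ p ∧
      (1 + 4 * ε) ^ p * Fintype.card ι ≤ ε / 4 * ∑ t, (1 + w t) ^ p := by
  have hN : (0 : ℝ) < Fintype.card ι := by exact_mod_cast Fintype.card_pos
  have hK2 : (2 : ℝ) ≤ K := by exact_mod_cast hK
  have hinv : 4 ≤ 1 / ε := by rw [le_div_iff₀ hε]; linarith
  obtain ⟨m, hm⟩ : ∃ m : ℕ, m = ⌈2 * K / ε⌉₊ := ⟨_, rfl⟩
  obtain ⟨j, hj⟩ : ∃ j : ℕ, j = ⌈4 / ε⌉₊ := ⟨_, rfl⟩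
  have hm1 : 2 * K / ε ≤ m := by rw [hm]; exact Nat.le_ceil _
  have hj1 : 4 / ε ≤ j := by rw [hj]; exact Nat.le_ceil _
  have hm2 : (m : ℝ) ≤ 3 * K / ε := by
    have := (Nat.ceil_lt_add_one (show 0 ≤ 2 * K / ε by positivity)).le
    rw [← hm] at this
    refine this.trans ?_
    have : 1 ≤ K * (1 / ε) := by nlinarith
    calc 2 * K / ε + 1 ≤ 2 * K / ε + K * (1 / ε) := by gcongr
      _ = _ := by ring
  have hj2 : (j : ℝ) ≤ 5 / ε := by
    have := (Nat.ceil_lt_add_one (show 0 ≤ 4 / ε by positivity)).le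
    rw [← hj] at this
    refine this.trans ?_
    calc 4 / ε + 1 ≤ 4 / ε + 1 / ε := by gcongr; linarith
      _ = _ := by ring
  have hKm : K ≤ m := by
    have : (K : ℝ) ≤ m := by
      refine le_trans ?_ hm1
      rw [le_div_iff₀ hε]
      nlinarith
    exact_mod_cast this
  have hj0 : 0 < j := by
    have : (0 : ℝ) < j := lt_of_lt_of_le (by positivity) hj1
    exact_mod_cast this
  have hgm : Real.exp (13 * K) * Fintype.card ι ≤ ∑ t, (1 + w t) ^ m := by
    have hpos : 0 ≤ ∑ t, w t ^ K := hw K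
    calc Real.exp (13 * K) * Fintype.card ι
        = (1 / ε) ^ K * ((Real.exp 13 * ε) ^ K * Fintype.card ι) := by
          rw [mul_comm (13 : ℝ), Real.exp_nat_mul, mul_pow, one_div, inv_pow]
          field_simp
      _ ≤ (1 / ε) ^ K * ∑ t, w t ^ K := by gcongr
      _ ≤ m.choose K * ∑ t, w t ^ K := by
          gcongr
          exact inv_pow_le_choose hε (by linarith) (by omega) hm1
      _ ≤ _ := choose_mul_sum_pow_le hw hKm
  have hgp : Real.exp (13 * K * j) * Fintype.card ι ≤ ∑ t, (1 + w t) ^ (m * j) := by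
    obtain ⟨i, rfl⟩ := Nat.exists_eq_succ_of_ne_zero hj0.ne'
    have hJ := pow_sum_div_card_le_sum_pow (s := Finset.univ) (f := fun t => (1 + w t) ^ m)
      (fun t _ => pow_nonneg (hw1 t) m) i
    simp_rw [← pow_mul] at hJ
    refine le_trans ?_ hJ
    rw [Finset.card_univ, le_div_iff₀ (by positivity)]
    calc _ = (Real.exp (13 * K) * Fintype.card ι) ^ (i + 1) := by
          rw [mul_pow, ← Real.exp_nat_mul, pow_succ (Fintype.card ι : ℝ), mul_comm (13 * K : ℝ)]
          push_cast
          ring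
      _ ≤ _ := by gcongr
  have hp : ((m * j : ℕ) : ℝ) = m * j := by push_cast; ring
  have hjpos : (0 : ℝ) < j := by exact_mod_cast hj0
  refine ⟨m * j, ?_, ?_, ?_, ?_⟩
  · rw [hp]
    calc 16 / ε ^ 2 = 2 * 2 / ε * (4 / ε) := by field_simp; norm_num
      _ ≤ 2 * K / ε * (4 / ε) := by gcongr
      _ ≤ _ := by gcongr
  · rw [hp]
    calc (m * j : ℝ) ≤ 3 * K / ε * (5 / ε) := by gcongr
      _ = _ := by field_simp; norm_num
  · refine lt_of_lt_of_le ?_ hgp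
    refine lt_mul_of_one_lt_left hN ?_
    rw [Real.one_lt_exp_iff]
    positivity
  · have h1 : (1 + 4 * ε) ^ (m * j) ≤ Real.exp (12 * K * j) := by
      calc (1 + 4 * ε) ^ (m * j) ≤ Real.exp (4 * ε) ^ (m * j) := by
            gcongr
            linarith [Real.add_one_le_exp (4 * ε)]
        _ = Real.exp (m * j * (4 * ε)) := by rw [← Real.exp_nat_mul, hp]
        _ ≤ Real.exp (3 * K / ε * j * (4 * ε)) := by gcongr
        _ = _ := by congr 1; field_simp; norm_num
    have h2 : 1 ≤ ε / 4 * Real.exp (K * j) := by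
      have h3 : (j : ℝ) ≤ Real.exp (K * j) := by
        have := Real.add_one_le_exp (K * j : ℝ)
        nlinarith
      calc 1 = ε / 4 * (4 / ε) := by field_simp
        _ ≤ _ := by gcongr; exact hj1.trans h3
    calc _ ≤ Real.exp (12 * K * j) * Fintype.card ι := by gcongr
      _ ≤ ε / 4 * Real.exp (K * j) * (Real.exp (12 * K * j) * Fintype.card ι) :=
          le_mul_of_one_le_left (by positivity) h2
      _ = ε / 4 * (Real.exp (13 * K * j) * Fintype.card ι) := by
          rw [show (13 * K * j : ℝ) = K * j + 12 * K * j by ring, Real.exp_add]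
          ring
      _ ≤ _ := by gcongr

end moments

section balanced

variable {G : Type*} [AddCommGroup G] [Fintype G]

theorem sum_dens {A : Finset G} (hA : A.Nonempty) : ∑ x, dens A x = Fintype.card G := by
  have : (A.card : ℝ) ≠ 0 := by exact_mod_cast hA.card_pos.ne'
  simp only [dens, Finset.sum_ite_mem, Finset.univ_inter, Finset.sum_const, nsmul_eq_mul]
  field_simp

theorem autocorr_dens_sub_one {A : Finset G} (hA : A.Nonempty) (t : G) :
    autocorr (fun x => dens A x - 1) t = autocorr (dens A) t - Fintype.card G := by
  have h1 : ∑ z, dens A (z + t) = Fintype.card G := by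
    rw [← sum_dens hA]
    exact Equiv.sum_comp (Equiv.addRight t) (dens A)
  have h2 : ∀ z, (dens A z - 1) * (dens A (z + t) - 1) =
      dens A z * dens A (z + t) - dens A z - dens A (z + t) + 1 := fun z => by ring
  simp only [autocorr, h2, Finset.sum_add_distrib, Finset.sum_sub_distrib, h1, sum_dens hA,
    Finset.sum_const, nsmul_eq_mul, Finset.card_univ]
  ring

theorem convC_dens_sub_one {A B : Finset G} (hA : A.Nonempty) (hB : B.Nonempty) (x : G) :
    convC (dens A) (dens B) x - 1 =
      (∑ y, (dens A y - 1) * (dens B (x - y) - 1)) / Fintype.card G := by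
  have hN : (Fintype.card G : ℝ) ≠ 0 := by exact_mod_cast Fintype.card_ne_zero
  have h1 : ∑ y, dens B (x - y) = Fintype.card G := by
    rw [← sum_dens hB]
    exact Equiv.sum_comp (Equiv.subLeft x) (dens B)
  have h2 : ∀ y, (dens A y - 1) * (dens B (x - y) - 1) =
      dens A y * dens B (x - y) - dens A y - dens B (x - y) + 1 := fun y => by ring
  simp only [convC, h2, Finset.sum_add_distrib, Finset.sum_sub_distrib, h1, sum_dens hA,
    Finset.sum_const, nsmul_eq_mul, Finset.card_univ]
  field_simp
  ring

theorem autocorr_dens (A : Finset G) (t : G) : autocorr (dens A) t =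
    (Fintype.card G / A.card : ℝ) ^ 2 * autocorr (fun x => if x ∈ A then 1 else 0) t := by
  simp only [autocorr, Finset.mul_sum, dens]
  refine Finset.sum_congr rfl fun z _ => ?_
  split_ifs <;> ring

/-- The moments of `A * B - 1` are controlled by the autocorrelations of the two balanced
density functions. -/
theorem knorm_convC_dens_sub_one_le {A B : Finset G} (hA : A.Nonempty) (hB : B.Nonempty)
    {k : ℕ} (hk : k ≠ 0) {η : ℝ} (hη : 0 ≤ η)
    (hwA : ∑ t, (autocorr (fun x => dens A x - 1) t / Fintype.card G) ^ (2 * k) ≤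
      η ^ (2 * k) * Fintype.card G)
    (hwB : ∑ t, (autocorr (fun x => dens B x - 1) t / Fintype.card G) ^ (2 * k) ≤
      η ^ (2 * k) * Fintype.card G) :
    knorm k (fun x => convC (dens A) (dens B) x - 1) ≤ η := by
  have hN : (0 : ℝ) < Fintype.card G := by exact_mod_cast Fintype.card_pos
  set N : ℝ := (Fintype.card G : ℝ)
  have h1 : (∑ x, (convC (dens A) (dens B) x - 1) ^ (2 * k)) ^ 2 ≤
      (η ^ (2 * k) * N) * (η ^ (2 * k) * N) := by
    have h := sq_sum_conv_pow_le (fun x => dens A x - 1) (fun x => dens B x - 1) (2 * k)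
    simp_rw [convC_dens_sub_one hA hB, div_pow, ← Finset.sum_div]
    simp_rw [div_pow, ← Finset.sum_div] at hwA hwB
    refine le_trans ?_ (mul_le_mul hwA hwB ?_ (by positivity))
    · rw [div_mul_div_comm, div_pow, ← sq]
      gcongr
    · exact div_nonneg (sum_autocorr_pow_nonneg _ _) (by positivity)
  have h2 : ∑ x, (convC (dens A) (dens B) x - 1) ^ (2 * k) ≤ η ^ (2 * k) * N :=
    abs_le_of_sq_le_sq' (by rwa [← sq] at h1) (by positivity) |>.2
  have h3 : (∑ x, |convC (dens A) (dens B) x - 1| ^ k) ^ 2 ≤ (η ^ k * N) ^ 2 := by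
    refine (sq_sum_le_card_mul_sum_sq (s := Finset.univ)).trans ?_
    simp_rw [← pow_mul, mul_comm k 2, pow_mul |_|, sq_abs, ← pow_mul]
    rw [Finset.card_univ]
    calc N * _ ≤ N * (η ^ (2 * k) * N) := by gcongr
      _ = _ := by ring
  have h4 : ∑ x, |convC (dens A) (dens B) x - 1| ^ k ≤ η ^ k * N :=
    abs_le_of_sq_le_sq' h3 (by positivity) |>.2
  calc knorm k (fun x => convC (dens A) (dens B) x - 1) ≤ (η ^ k) ^ ((1 : ℝ) / k) := by
        unfold knorm
        gcongr
        rw [div_le_iff₀ hN]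
        exact h4
    _ = η := by rw [one_div, Real.pow_rpow_inv_natCast hη hk]

end balanced

section spread

variable {F G : Type*} [Field F] [AddCommGroup G] [Module F G]

theorem sum_diffMean_le {A S : Finset G} (hA : A.Nonempty) {W : Submodule F G}
    [Fintype W] {φ : G → ℝ} {c : ℝ} (hφ0 : ∀ t, 0 ≤ φ t) (hSφ : ∀ t ∈ S, 1 ≤ φ t)
    (hφ : ∀ x, ∑ v : W, φ (x + v) ≤ c) : ∑ v : W, diffMean A S v ≤ c := by
  have hcA : (0 : ℝ) < A.card := by exact_mod_cast hA.card_pos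
  have h : ∑ v : W, diffMean A S v =
      (∑ a ∈ A, ∑ b ∈ A, ∑ v : W, if (v : G) - a + b ∈ S then (1 : ℝ) else 0) /
        (A.card * A.card) := by
    simp only [diffMean, shiftMean, ← Finset.sum_div, div_div]
    rw [Finset.sum_comm]
    congr 1
    refine Finset.sum_congr rfl fun a _ => ?_
    rw [Finset.sum_comm]
  rw [h, div_le_iff₀ (by positivity)]
  calc _ ≤ ∑ a ∈ A, ∑ b ∈ A, c := by
        gcongr with a _ b _
        refine le_trans (Finset.sum_le_sum fun v _ => ?_) (hφ (b - a))
        rw [show (v : G) - a + b = b - a + v by abel]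
        split_ifs with ht
        · exact hSφ _ ht
        · exact hφ0 _
    _ = _ := by
        simp only [Finset.sum_const, nsmul_eq_mul]
        ring

theorem one_sub_le_diffMean_zero {A S : Finset G} (hA : A.Nonempty) {δ : ℝ}
    (h : ∑ x ∈ A, ∑ y ∈ A, (if y - x ∈ S then (0 : ℝ) else 1) ≤ δ * A.card ^ 2) :
    1 - δ ≤ diffMean A S 0 := by
  have hcA : (0 : ℝ) < A.card := by exact_mod_cast hA.card_pos
  have h1 : diffMean A S 0 =
      (∑ x ∈ A, ∑ y ∈ A, (1 - if y - x ∈ S then (0 : ℝ) else 1)) / A.card ^ 2 := by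
    simp only [diffMean, shiftMean, ← Finset.sum_div, div_div, ← sq]
    congr 1
    refine Finset.sum_congr rfl fun x _ => Finset.sum_congr rfl fun y _ => ?_
    rw [zero_sub, neg_add_eq_sub]
    split_ifs <;> norm_num
  rw [h1, le_div_iff₀ (by positivity)]
  simp only [Finset.sum_sub_distrib, Finset.sum_const, nsmul_eq_mul]
  linarith

variable [Fintype G]

theorem sum_dens_coset_le {A : Finset G} (hA : A.Nonempty)
    {W : Submodule F G} [Fintype W] {c : ℝ}
    (h : ∀ θ, ((A.filter fun x => x - θ ∈ W).card : ℝ) * Fintype.card G ≤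
      c * A.card * Nat.card W) (y : G) :
    ∑ v : W, dens A (y + v) ≤ c * Nat.card W := by
  have hcA : (0 : ℝ) < A.card := by exact_mod_cast hA.card_pos
  have h1 : (Finset.univ.filter fun v : W => y + (v : G) ∈ A).card =
      (A.filter fun x => x - y ∈ W).card := by
    refine Finset.card_bij (fun v _ => y + v) ?_ ?_ ?_
    · intro v hv
      simpa using hv
    · intro v _ v' _ hvv
      simpa using hvv
    · intro x hx
      rw [Finset.mem_filter] at hx
      exact ⟨⟨x - y, hx.2⟩, by simpa using hx.1, by simp⟩
  simp only [dens]
  rw [← Finset.sum_filter, Finset.sum_const, h1, nsmul_eq_mul, ← mul_div_assoc,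
    div_le_iff₀ hcA]
  linarith [h y]

theorem sum_autocorr_dens_coset_le {A : Finset G} (hA : A.Nonempty)
    {W : Submodule F G} [Fintype W] {c : ℝ}
    (h : ∀ θ, ((A.filter fun x => x - θ ∈ W).card : ℝ) * Fintype.card G ≤
      c * A.card * Nat.card W) (x : G) :
    ∑ v : W, autocorr (dens A) (x + v) / Fintype.card G ≤ c * Nat.card W := by
  have hN : (0 : ℝ) < Fintype.card G := by exact_mod_cast Fintype.card_pos
  rw [← Finset.sum_div, div_le_iff₀ hN]
  simp only [autocorr]
  rw [Finset.sum_comm]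
  calc _ = ∑ z, dens A z * ∑ v : W, dens A (z + x + v) := by
        simp only [Finset.mul_sum, add_assoc]
    _ ≤ ∑ z, dens A z * (c * Nat.card W) := by
        gcongr with z
        · unfold dens
          positivity
        · exact sum_dens_coset_le hA h _
    _ = _ := by rw [← Finset.sum_mul, sum_dens hA, mul_comm]

end spread

/-- If the balanced density of `A` has a large autocorrelation moment, then there is a reasonably
dense set almost all of whose differences have large autocorrelation in `A`. -/
theorem exists_sifted_set_of_large_moment {G : Type*} [AddCommGroup G] [Fintype G] {A : Finset G}
    (hAne : A.Nonempty) {k : ℕ} (hk : 1 ≤ k) {ε : ℝ} (hε : 0 < ε) (hε' : ε ≤ 1 / 4)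
    (hlt : (Real.exp 13 * ε) ^ (2 * k) * Fintype.card G <
      ∑ t, (autocorr (fun x => dens A x - 1) t / Fintype.card G) ^ (2 * k)) :
    ∃ (p : ℕ) (A' S : Finset G), 16 / ε ^ 2 ≤ p ∧ p ≤ 30 * k / ε ^ 2 ∧
      (A.card / Fintype.card G : ℝ) ^ p / 2 * Fintype.card G < A'.card ∧
      1 - ε / 2 ≤ diffMean A' S 0 ∧
      ∀ t ∈ S, 1 + 4 * ε < autocorr (dens A) t / Fintype.card G := by
  have hN : (0 : ℝ) < Fintype.card G := by exact_mod_cast Fintype.card_pos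
  have hcA : (0 : ℝ) < A.card := by exact_mod_cast hAne.card_pos
  obtain ⟨g, hg⟩ : ∃ g : G → ℝ, g = fun t =>
    autocorr (dens A) t / Fintype.card G := ⟨_, rfl⟩
  have hwg : ∀ t, 1 + autocorr (fun x => dens A x - 1) t / Fintype.card G = g t := by
    intro t
    rw [hg, autocorr_dens_sub_one hAne]
    field_simp
    ring
  have hg0 : ∀ t, 0 ≤ g t := by
    intro t
    rw [hg]
    unfold autocorr dens
    positivity
  obtain ⟨p, hp1, hp2, hgp1, hgp2⟩ := exists_large_moment
    (w := fun t => autocorr (fun x => dens A x - 1) t / Fintype.card G)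
    (fun i => by
      simp_rw [div_pow, ← Finset.sum_div]
      exact div_nonneg (sum_autocorr_pow_nonneg _ _) (by positivity))
    (fun t => by rw [hwg]; exact hg0 t) (show 2 ≤ 2 * k by omega) hε hε' hlt
  simp only [hwg] at hgp1 hgp2
  obtain ⟨S, hS⟩ : ∃ S : Finset G, S = Finset.univ.filter fun t => 1 + 4 * ε < g t :=
    ⟨_, rfl⟩
  obtain ⟨b, hb⟩ : ∃ b : ℝ, b = (A.card : ℝ) ^ 2 / Fintype.card G := ⟨_, rfl⟩
  have hb0 : 0 < b := by rw [hb]; positivity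
  have hrg : ∀ t, autocorr (fun x => if x ∈ A then (1 : ℝ) else 0) t ^ p = b ^ p * g t ^ p := by
    intro t
    rw [← mul_pow, hg, hb]
    dsimp only
    rw [autocorr_dens]
    congr 1
    field_simp
  have hSc : ∑ t ∈ Sᶜ, g t ^ p ≤ ε / 4 * ∑ t, g t ^ p := by
    refine le_trans ?_ hgp2
    calc ∑ t ∈ Sᶜ, g t ^ p ≤ ∑ t ∈ Sᶜ, (1 + 4 * ε) ^ p := by
          refine Finset.sum_le_sum fun t ht => pow_le_pow_left₀ (hg0 t) ?_ p
          rw [hS, Finset.mem_compl, Finset.mem_filter] at ht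
          simpa using ht
      _ ≤ ∑ t : G, (1 + 4 * ε) ^ p :=
          Finset.sum_le_univ_sum_of_nonneg fun _ => by positivity
      _ = _ := by
          rw [Finset.sum_const, nsmul_eq_mul, mul_comm, Finset.card_univ]
  obtain ⟨A', hA'1, hA'2⟩ := exists_sifted_set A S p (show 0 < ε / 4 by positivity)
    (by
      simp only [hrg, ← Finset.mul_sum]
      calc _ ≤ b ^ p * (ε / 4 * ∑ t, g t ^ p) := by gcongr
        _ = _ := by ring)
    (by
      simp only [hrg, ← Finset.mul_sum]
      calc (A.card : ℝ) ^ (2 * p) = (Fintype.card G : ℝ) ^ p /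
            Fintype.card G * (b ^ p * Fintype.card G) := by
            rw [hb, div_pow, pow_mul]
            field_simp
        _ < _ := by gcongr)
  have hcA' : (0 : ℝ) < A'.card := lt_of_le_of_lt (by positivity) hA'1
  have hA'ne : A'.Nonempty := Finset.card_pos.1 (by exact_mod_cast hcA')
  refine ⟨p, A', S, hp1, hp2.trans_eq (by push_cast; ring), hA'1, ?_, fun t ht => ?_⟩
  · refine one_sub_le_diffMean_zero hA'ne ?_
    convert hA'2 using 1
    ring
  · rw [hS, Finset.mem_filter, hg] at ht
    exact ht.2

/-- A spread set has small autocorrelation moments. -/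
theorem sum_autocorr_dens_sub_one_pow_le {F : Type*} [Field F] [Fintype F]
    {n : ℕ} {A : Finset (Fin n → F)} {d : ℝ} (hd : 1 ≤ d)
    (hA : (2 : ℝ) ^ (-d) * Fintype.card (Fin n → F) ≤ A.card) {k : ℕ} (hk : 1 ≤ k) {ε : ℝ}
    (hε : 0 < ε) (hε' : ε ≤ 1 / 4) {r : ℕ} (hr : d ^ 4 * (k : ℝ) ^ 4 / ε ^ 33 ≤ r)
    (h : ∀ (W : Submodule F (Fin n → F)) (θ : Fin n → F), n ≤ Module.finrank F W + r →
      ((A.filter fun x => x - θ ∈ W).card : ℝ) * Fintype.card (Fin n → F) ≤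
        (1 + ε) * A.card * Nat.card W) :
    ∑ t, (autocorr (fun x => dens A x - 1) t / Fintype.card (Fin n → F)) ^ (2 * k) ≤
      (Real.exp 13 * ε) ^ (2 * k) * Fintype.card (Fin n → F) := by
  have hN : (0 : ℝ) < Fintype.card (Fin n → F) := by exact_mod_cast Fintype.card_pos
  have hcA : (0 : ℝ) < A.card := lt_of_lt_of_le (by positivity) hA
  have hAne : A.Nonempty := Finset.card_pos.1 (by exact_mod_cast hcA)
  by_contra! hlt
  obtain ⟨p, A', S, hp1, hp2, hA'1, hdm, hS⟩ :=
    exists_sifted_set_of_large_moment hAne hk hε hε' hlt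
  have hcA' : (0 : ℝ) < A'.card := lt_of_le_of_lt (by positivity) hA'1
  have hA'ne : A'.Nonempty := Finset.card_pos.1 (by exact_mod_cast hcA')
  have hp16 : 16 * 16 ≤ (p : ℝ) := by
    refine le_trans ?_ hp1
    rw [le_div_iff₀ (by positivity)]
    nlinarith
  have hp0 : (0 : ℝ) < p := by linarith
  obtain ⟨D, hD⟩ : ∃ D : ℕ, D = ⌈d * p⌉₊ + 1 := ⟨_, rfl⟩
  have hdp : d * p + 1 ≤ D := by
    rw [hD]
    push_cast
    gcongr
    exact Nat.le_ceil _
  have hDp : (D : ℝ) ≤ 3 * (d * p) := by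
    have h1 := (Nat.ceil_lt_add_one (show 0 ≤ d * p by positivity)).le
    have h2 : (D : ℝ) = ⌈d * p⌉₊ + 1 := by rw [hD]; push_cast; ring
    nlinarith
  have hpD : (p : ℝ) ≤ D := by nlinarith
  have hAD : (Fintype.card (Fin n → F) : ℝ) ≤ 2 ^ D * A'.card := by
    have h1 : (2 : ℝ) ^ (-d) ≤ A.card / Fintype.card (Fin n → F) := by
      rwa [le_div_iff₀ hN]
    have h2 : (1 : ℝ) ≤ 2 ^ D * (((2 : ℝ) ^ (-d)) ^ p / 2) := by
      rw [← Real.rpow_mul_natCast two_pos.le, ← Real.rpow_natCast 2 D, ← mul_div_assoc,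
        ← Real.rpow_add two_pos, le_div_iff₀ two_pos, one_mul]
      nth_rewrite 1 [← Real.rpow_one 2]
      gcongr
      · norm_num
      · linarith
    calc (Fintype.card (Fin n → F) : ℝ) = 1 * Fintype.card (Fin n → F) := by ring
      _ ≤ 2 ^ D * (((2 : ℝ) ^ (-d)) ^ p / 2) * Fintype.card (Fin n → F) := by gcongr
      _ ≤ 2 ^ D * ((A.card / Fintype.card (Fin n → F) : ℝ) ^ p / 2) * Fintype.card (Fin n → F) := by
          gcongr
      _ = 2 ^ D * ((A.card / Fintype.card (Fin n → F) : ℝ) ^ p / 2 * Fintype.card (Fin n → F)) := by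
          ring
      _ ≤ _ := by gcongr
  obtain ⟨W, m, hWm, hm, hW⟩ := exists_submodule_diffMean_ge hA'ne S hε hε' (hp1.trans hpD) hAD
  have hmr : m ≤ r := by
    have h1 : (4 : ℝ) ^ 13 ≤ 1 / ε ^ 13 := by
      rw [le_div_iff₀ (by positivity), ← mul_pow]
      exact pow_le_one₀ (by positivity) (by linarith)
    have h2 : (D : ℝ) ≤ 90 * (d * k / ε ^ 2) := by
      calc (D : ℝ) ≤ 3 * (d * p) := hDp
        _ ≤ 3 * (d * (30 * k / ε ^ 2)) := by gcongr
        _ = _ := by ring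
    have h3 : (m : ℝ) ≤ r := by
      calc (m : ℝ) ≤ D ^ 4 / ε ^ 12 := hm
        _ ≤ (90 * (d * k / ε ^ 2)) ^ 4 / ε ^ 12 := by gcongr
        _ = 90 ^ 4 * (d ^ 4 * k ^ 4 / ε ^ 20) := by field_simp
        _ ≤ 4 ^ 13 * (d ^ 4 * k ^ 4 / ε ^ 20) := by gcongr; norm_num
        _ ≤ 1 / ε ^ 13 * (d ^ 4 * k ^ 4 / ε ^ 20) := by gcongr
        _ = d ^ 4 * k ^ 4 / ε ^ 33 := by field_simp
        _ ≤ r := hr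
    exact_mod_cast h3
  have hWpos : (0 : ℝ) < Nat.card W := by exact_mod_cast Nat.card_pos
  have hupper : ∑ v : W, diffMean A' S v ≤ (1 + ε) * Nat.card W / (1 + 4 * ε) := by
    refine sum_diffMean_le (φ := fun t =>
      autocorr (dens A) t / Fintype.card (Fin n → F) / (1 + 4 * ε)) hA'ne (fun t => ?_)
      (fun t ht => ?_) fun x => ?_
    · unfold autocorr dens
      positivity
    · rw [le_div_iff₀ (by positivity), one_mul]
      exact (hS t ht).le
    rw [← Finset.sum_div]
    gcongr
    exact sum_autocorr_dens_coset_le hAne (fun θ => h W θ (by omega)) x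
  have hlower : (1 - ε) * Nat.card W ≤ ∑ v : W, diffMean A' S v := by
    calc (1 - ε) * Nat.card W = ∑ v : W, (1 - ε) := by
          rw [Finset.sum_const, nsmul_eq_mul, mul_comm, Finset.card_univ, Nat.card_eq_fintype_card]
      _ ≤ _ := Finset.sum_le_sum fun v _ => by linarith [hW v v.2]
  have hcontr := hlower.trans hupper
  rw [le_div_iff₀ (by positivity)] at hcontr
  nlinarith [mul_pos hε hWpos]

/-- Near-uniformity from spreadness: if `A` and `B` are both `(1+ε, r)`-spread with
`r ≥ d⁴k⁴/ε^c`, then `‖A * B − 1‖_k ≤ C·ε`. -/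
theorem near_uniformity_from_spreadness :
    ∃ c : ℝ, 1 ≤ c ∧ ∃ C : ℝ, 1 ≤ C ∧
    ∀ (F : Type) [Field F] [Fintype F] [DecidableEq F] (n : ℕ), 1 ≤ n →
    ∀ d : ℝ, 1 ≤ d → ∀ A B : Finset (Fin n → F),
    (2:ℝ) ^ (-d) * (Fintype.card F : ℝ) ^ n ≤ A.card →
    (2:ℝ) ^ (-d) * (Fintype.card F : ℝ) ^ n ≤ B.card →
    ∀ k : ℕ, 1 ≤ k → ∀ ε : ℝ, 0 < ε → ε ≤ 1/4 → ∀ r : ℕ, 0 < r →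
    d ^ 4 * (k:ℝ) ^ 4 / ε ^ c ≤ (r : ℝ) →
    (∀ (W : Submodule F (Fin n → F)) (θ : Fin n → F),
      (n : ℕ) ≤ Module.finrank F W + r →
      ((A.filter fun x => x - θ ∈ W).card : ℝ) * (Fintype.card F : ℝ) ^ n ≤
          (1 + ε) * (A.card : ℝ) * (Nat.card W : ℝ) ∧
        ((B.filter fun x => x - θ ∈ W).card : ℝ) * (Fintype.card F : ℝ) ^ n ≤
          (1 + ε) * (B.card : ℝ) * (Nat.card W : ℝ)) →
    knorm k (fun x => convC (dens A) (dens B) x - 1) ≤ C * ε := by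
  refine ⟨33, by norm_num, Real.exp 13, Real.one_le_exp (by norm_num), ?_⟩
  intro F _ _ _ n _ d hd A B hA hB k hk ε hε hε' r _ hr hspread
  have hN : (Fintype.card F : ℝ) ^ n = Fintype.card (Fin n → F) := by simp
  rw [hN] at hA hB hspread
  rw [show (33 : ℝ) = ((33 : ℕ) : ℝ) by norm_num, Real.rpow_natCast] at hr
  have hne : ∀ S : Finset (Fin n → F),
      (2 : ℝ) ^ (-d) * Fintype.card (Fin n → F) ≤ S.card → S.Nonempty := fun S hS => by
    have hpos : (0 : ℝ) < Fintype.card (Fin n → F) := by exact_mod_cast Fintype.card_pos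
    have : (0 : ℝ) < S.card := lt_of_lt_of_le (by positivity) hS
    exact Finset.card_pos.1 (by exact_mod_cast this)
  convert knorm_convC_dens_sub_one_le (hne A (by convert hA)) (hne B (by convert hB))
    (by omega : k ≠ 0) (by positivity : 0 ≤ Real.exp 13 * ε)
    (sum_autocorr_dens_sub_one_pow_le hd (by convert hA) hk hε hε' hr fun W θ hW => ?_)
    (sum_autocorr_dens_sub_one_pow_le hd (by convert hB) hk hε hε' hr fun W θ hW => ?_)
  · convert (hspread W θ hW).1
  · convert (hspread W θ hW).2
end

section
/- Let G be an abelian group, let A ⊆ G be a finite nonempty subset, let f : G → ℝ be nonnegative, and let k ≥ 2 be an integer. For x ∈ G set R(x) := #{(a, b) ∈ A × A : a − b = x}. Then there exist s₁, …, s_{k−1} ∈ G such that, setting A′ := A ∩ (A + s₁) ∩ ⋯ ∩ (A + s_{k−1}), one has: (1) (Σ_{x} R(x)^k) · (Σ_{a∈A′} Σ_{b∈A′} f(a − b)) ≤ 2 · (Σ_{x} R(x)^k · f(x)) · |A′|²; and (2) 2 · |A′| · |A|^k ≥ Σ_{x} R(x)^k. (All sums over x range over the finite set A − A, outside of which R vanishes.)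 -/
open Pointwise

section Sifting

open Finset

variable {G ι : Type*} [AddCommGroup G] [DecidableEq G] [Fintype ι] [DecidableEq ι]

lemma sum_sum_filter_eq_sum_card_mul {α β : Type*} (S : Finset α) (B : Finset β)
    (P : α → β → Prop) [∀ s, DecidablePred (P s)] [∀ b, DecidablePred fun s => P s b] (w : β → ℝ) :
    ∑ s ∈ S, ∑ b ∈ B with P s b, w b = ∑ b ∈ B, (#{s ∈ S | P s b} : ℝ) * w b := by
  simp_rw [sum_filter]
  rw [sum_comm]
  refine sum_congr rfl fun b _ => ?_
  rw [← sum_filter, sum_const, nsmul_eq_mul]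

lemma card_filter_piFinset_const {α : Type*} (T : Finset α) (p : α → Prop)
    [DecidablePred p] :
    #{s ∈ Fintype.piFinset fun _ : ι => T | ∀ i, p (s i)} = #{t ∈ T | p t} ^ Fintype.card ι := by
  have h : {s ∈ Fintype.piFinset fun _ : ι => T | ∀ i, p (s i)} =
      Fintype.piFinset fun _ : ι => {t ∈ T | p t} := by
    ext s
    simp [Fintype.mem_piFinset, forall_and]
  rw [h, Fintype.card_piFinset, prod_const, card_univ]

lemma card_filter_sub_mem (A : Finset G) {a : G} (ha : a ∈ A) :
    #{t ∈ A - A | a - t ∈ A} = #A := by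
  refine card_nbij' (fun t => a - t) (fun u => a - u) ?_ ?_ ?_ ?_
  · intro t ht
    exact (mem_filter.1 ht).2
  · intro u hu
    exact mem_filter.2 ⟨sub_mem_sub ha hu, by simpa using hu⟩
  · intro t _
    simp
  · intro u _
    simp

lemma card_filter_sub_mem_and_sub_mem (A : Finset G) {a : G} (ha : a ∈ A) (b : G) :
    #{t ∈ A - A | a - t ∈ A ∧ b - t ∈ A} = #{p ∈ A ×ˢ A | p.1 - p.2 = a - b} := by
  refine card_nbij' (fun t => (a - t, b - t)) (fun p => a - p.1) ?_ ?_ ?_ ?_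
  · intro t ht
    simpa using (mem_filter.1 ht).2
  · rintro ⟨u, v⟩ hp
    obtain ⟨hp, h⟩ := mem_filter.1 hp
    obtain ⟨hu, hv⟩ := mem_product.1 hp
    have h' : b - (a - u) = v := by
      rw [← sub_sub_self u v, show u - v = a - b from h]
      abel
    refine mem_filter.2 ⟨sub_mem_sub ha hu, ?_, ?_⟩
    · simpa using hu
    · simpa [h'] using hv
  · intro t _
    simp
  · rintro ⟨u, v⟩ hp
    have h : u - v = a - b := (mem_filter.1 hp).2
    have h' : b - (a - u) = v := by
      rw [← sub_sub_self u v, h]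
      abel
    simp [h']

/-- The intersection of `A` with its translates by the `s i`. -/
def sift (A : Finset G) (s : ι → G) : Finset G := {a ∈ A | ∀ i, a - s i ∈ A}

lemma sum_card_sift (A : Finset G) :
    ∑ s ∈ Fintype.piFinset fun _ : ι => A - A, (#(sift A s) : ℝ) = (#A : ℝ) ^ (Fintype.card ι + 1) := by
  have h := sum_sum_filter_eq_sum_card_mul (Fintype.piFinset fun _ : ι => A - A) A
    (fun s a => ∀ i, a - s i ∈ A) fun _ => 1
  simp only [sum_const, nsmul_eq_mul, mul_one] at h
  refine h.trans ?_
  calc ∑ a ∈ A, (#{s ∈ Fintype.piFinset fun _ : ι => A - A | ∀ i, a - s i ∈ A} : ℝ)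
      = ∑ a ∈ A, (#A : ℝ) ^ Fintype.card ι := by
        refine sum_congr rfl fun a ha => ?_
        rw [card_filter_piFinset_const (A - A) fun t => a - t ∈ A, card_filter_sub_mem A ha]
        push_cast
        rfl
    _ = (#A : ℝ) ^ (Fintype.card ι + 1) := by
        rw [sum_const, nsmul_eq_mul, pow_succ']

lemma sum_sum_sift (A : Finset G) (g : G → ℝ) :
    ∑ s ∈ Fintype.piFinset fun _ : ι => A - A, ∑ a ∈ sift A s, ∑ b ∈ sift A s, g (a - b) =
      ∑ x ∈ A - A, (#{p ∈ A ×ˢ A | p.1 - p.2 = x} : ℝ) ^ (Fintype.card ι + 1) * g x := by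
  have h := sum_sum_filter_eq_sum_card_mul (Fintype.piFinset fun _ : ι => A - A) (A ×ˢ A)
    (fun s p => ∀ i, p.1 - s i ∈ A ∧ p.2 - s i ∈ A) fun p => g (p.1 - p.2)
  calc ∑ s ∈ Fintype.piFinset fun _ : ι => A - A, ∑ a ∈ sift A s, ∑ b ∈ sift A s, g (a - b)
      = ∑ s ∈ Fintype.piFinset fun _ : ι => A - A,
          ∑ p ∈ A ×ˢ A with ∀ i, p.1 - s i ∈ A ∧ p.2 - s i ∈ A, g (p.1 - p.2) := by
        refine sum_congr rfl fun s _ => ?_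
        rw [← sum_product']
        refine sum_congr ?_ fun _ _ => rfl
        ext p
        simp only [sift, mem_product, mem_filter, forall_and]
        tauto
    _ = ∑ p ∈ A ×ˢ A, (#{q ∈ A ×ˢ A | q.1 - q.2 = p.1 - p.2} : ℝ) ^ Fintype.card ι *
          g (p.1 - p.2) := by
        refine h.trans (sum_congr rfl fun p hp => ?_)
        rw [card_filter_piFinset_const (A - A) fun t => p.1 - t ∈ A ∧ p.2 - t ∈ A,
          card_filter_sub_mem_and_sub_mem A (mem_product.1 hp).1]
        push_cast
        rfl
    _ = _ := by
        rw [← sum_fiberwise_of_maps_to (t := A - A) (g := fun p : G × G => p.1 - p.2)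
          fun p hp => sub_mem_sub (mem_product.1 hp).1 (mem_product.1 hp).2]
        refine sum_congr rfl fun x _ => ?_
        calc _ = ∑ p ∈ A ×ˢ A with p.1 - p.2 = x,
              (#{q ∈ A ×ˢ A | q.1 - q.2 = x} : ℝ) ^ Fintype.card ι * g x :=
              sum_congr rfl fun p hp => by rw [(mem_filter.1 hp).2]
          _ = _ := by rw [sum_const, nsmul_eq_mul, ← mul_assoc, pow_succ']

lemma sum_card_sift_sq (A : Finset G) :
    ∑ s ∈ Fintype.piFinset fun _ : ι => A - A, (#(sift A s) : ℝ) ^ 2 =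
      ∑ x ∈ A - A, (#{p ∈ A ×ˢ A | p.1 - p.2 = x} : ℝ) ^ (Fintype.card ι + 1) := by
  simpa [sq] using sum_sum_sift (ι := ι) A fun _ => 1

lemma sum_card_pow_pos {A : Finset G} (hA : A.Nonempty) (k : ℕ) :
    0 < ∑ x ∈ A - A, (#{p ∈ A ×ˢ A | p.1 - p.2 = x} : ℝ) ^ k := by
  refine sum_pos (fun x hx => ?_) (hA.sub hA)
  obtain ⟨a, ha, b, hb, rfl⟩ := mem_sub.1 hx
  have : 0 < #{p ∈ A ×ˢ A | p.1 - p.2 = a - b} :=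
    card_pos.2 ⟨(a, b), mem_filter.2 ⟨mk_mem_product ha hb, rfl⟩⟩
  positivity

/-- If `∑ c ≤ M` and `∑ c ^ 2 = N`, then the indices with `N ≤ 2 * c * M` carry at least half of
`∑ c ^ 2`, so the ratio of `F` to `c ^ 2` is at most twice its average at one of them. -/
lemma exists_le_two_mul_sum_mul_sq {α : Type*} (S : Finset α) {c F : α → ℝ} {M N : ℝ}
    (hc : ∀ s ∈ S, 0 ≤ c s) (hF : ∀ s ∈ S, 0 ≤ F s) (hM : ∑ s ∈ S, c s ≤ M) (hM₀ : 0 < M)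
    (hN : ∑ s ∈ S, c s ^ 2 = N) (hN₀ : 0 < N) :
    ∃ s ∈ S, N * F s ≤ 2 * (∑ t ∈ S, F t) * c s ^ 2 ∧ N ≤ 2 * c s * M := by
  classical
  have hsplit := sum_filter_add_sum_filter_not S (fun s => N ≤ 2 * c s * M) fun s => c s ^ 2
  have hsmall : 2 * ∑ s ∈ S with ¬ N ≤ 2 * c s * M, c s ^ 2 ≤ N := by
    refine le_of_mul_le_mul_right ?_ hM₀
    calc (2 * ∑ s ∈ S with ¬ N ≤ 2 * c s * M, c s ^ 2) * M
        = ∑ s ∈ S with ¬ N ≤ 2 * c s * M, c s * (2 * c s * M) := by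
          rw [mul_sum, sum_mul]
          exact sum_congr rfl fun s _ => by ring
      _ ≤ ∑ s ∈ S with ¬ N ≤ 2 * c s * M, c s * N := by
          refine sum_le_sum fun s hs => ?_
          obtain ⟨hs, h⟩ := mem_filter.1 hs
          exact mul_le_mul_of_nonneg_left (not_le.1 h).le (hc s hs)
      _ ≤ ∑ s ∈ S, c s * N :=
          sum_le_sum_of_subset_of_nonneg (filter_subset _ _) fun s hs _ =>
            mul_nonneg (hc s hs) hN₀.le
      _ ≤ N * M := by
          rw [← sum_mul, mul_comm]
          exact mul_le_mul_of_nonneg_left hM hN₀.le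
  have hlarge : N ≤ 2 * ∑ s ∈ S with N ≤ 2 * c s * M, c s ^ 2 := by linarith
  have hne : (S.filter fun s => N ≤ 2 * c s * M).Nonempty := by
    rw [nonempty_iff_ne_empty]
    intro h
    rw [h, sum_empty] at hlarge
    linarith
  have hF' : 0 ≤ ∑ t ∈ S, F t := sum_nonneg hF
  obtain ⟨s, hs, h⟩ := exists_le_of_sum_le hne (f := fun s => N * F s)
    (g := fun s => 2 * (∑ t ∈ S, F t) * c s ^ 2) <| by
      rw [← mul_sum, ← mul_sum]
      calc N * ∑ s ∈ S with N ≤ 2 * c s * M, F s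
          ≤ N * ∑ s ∈ S, F s :=
            mul_le_mul_of_nonneg_left
              (sum_le_sum_of_subset_of_nonneg (filter_subset _ _) fun s hs _ => hF s hs) hN₀.le
        _ ≤ (2 * ∑ s ∈ S with N ≤ 2 * c s * M, c s ^ 2) * ∑ s ∈ S, F s :=
            mul_le_mul_of_nonneg_right hlarge hF'
        _ = _ := by ring
  exact ⟨s, (mem_filter.1 hs).1, h, (mem_filter.1 hs).2⟩

end Sifting

/-- The sifting lemma (counting formulation). -/
theorem sifting_lemma {G : Type*} [AddCommGroup G] [DecidableEq G]
    (A : Finset G) (hA : A.Nonempty) (f : G → ℝ) (hf : ∀ x, 0 ≤ f x)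
    (k : ℕ) (hk : 2 ≤ k) :
    ∃ s : Fin (k-1) → G,
      ∃ A' : Finset G, A' = A.filter (fun a => ∀ i : Fin (k-1), a - s i ∈ A) ∧
      -- (1)
      (∑ x ∈ A - A, (((A ×ˢ A).filter fun p => p.1 - p.2 = x).card : ℝ) ^ k) *
          (∑ a ∈ A', ∑ b ∈ A', f (a - b)) ≤
        2 * (∑ x ∈ A - A, (((A ×ˢ A).filter fun p => p.1 - p.2 = x).card : ℝ) ^ k * f x) *
          (A'.card : ℝ) ^ 2 ∧
      -- (2)
      (∑ x ∈ A - A, (((A ×ˢ A).filter fun p => p.1 - p.2 = x).card : ℝ) ^ k) ≤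
        2 * (A'.card : ℝ) * (A.card : ℝ) ^ k := by
  obtain ⟨m, rfl⟩ : ∃ m, k = m + 1 := ⟨k - 1, by omega⟩
  have hS := exists_le_two_mul_sum_mul_sq (Fintype.piFinset fun _ : Fin (m + 1 - 1) => A - A)
    (c := fun s => ((sift A s).card : ℝ))
    (F := fun s => ∑ a ∈ sift A s, ∑ b ∈ sift A s, f (a - b))
    (fun s _ => Nat.cast_nonneg _)
    (fun s _ => Finset.sum_nonneg fun a _ => Finset.sum_nonneg fun b _ => hf _)
    (sum_card_sift A).le (pow_pos (Nat.cast_pos.2 hA.card_pos) _)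
    (sum_card_sift_sq A) (sum_card_pow_pos hA _)
  simp only [sum_sum_sift, Fintype.card_fin, Nat.add_sub_cancel] at hS
  obtain ⟨s, -, h₁, h₂⟩ := hS
  exact ⟨s, sift A s, by unfold sift; congr, h₁, h₂⟩
end

section
/- Let G be an abelian group, let A ⊆ G be a finite nonempty subset, let k ≥ 2 be an integer, and let c > 0. For x ∈ G set R(x) := #{(a, b) ∈ A × A : a − b = x}, and define κ > 0 by Σ_{x} R(x)^k = κ · |A|^{k+1}. Let S := {x ∈ G : R(x) ≤ c · κ^{1/(k−1)} · |A|}. Then there exists a subset A′ ⊆ A such that Σ_{a∈A′} Σ_{b∈A′} 1_S(a − b) ≤ 2·c^{k−1}·|A′|² and 2·|A′| ≥ κ·|A|. -/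
open Pointwise

section DifferenceTuples

variable {G : Type*} [AddCommGroup G] [DecidableEq G]

/-- The elements of `A` lying in every translate `A + x i`. -/
def translateInter (A : Finset G) {n : ℕ} (x : Fin n → G) : Finset G :=
  A.filter fun a => ∀ i, a - x i ∈ A

lemma card_common_differences (A : Finset G) {a : G} (b : G) (ha : a ∈ A) :
    ((A - A).filter fun x => a - x ∈ A ∧ b - x ∈ A).card =
      ((A ×ˢ A).filter fun p => p.1 - p.2 = a - b).card := by
  refine Finset.card_nbij' (fun x => (a - x, b - x)) (fun p => a - p.1) ?_ ?_ ?_ ?_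
  · intro x hx
    simp_all
  · rintro ⟨p, q⟩ hp
    simp only [Finset.coe_filter, Finset.mem_product, Set.mem_ofPred_eq] at hp
    obtain ⟨⟨hp, hq⟩, h⟩ := hp
    have hb : b - (a - p) = q := by rw [← sub_sub_cancel p q, h]; abel
    simp [hb, hp, hq, Finset.sub_mem_sub ha hp]
  · intro x _
    simp
  · rintro ⟨p, q⟩ hp
    simp only [Finset.coe_filter, Finset.mem_product, Set.mem_ofPred_eq] at hp
    obtain ⟨-, h⟩ := hp
    have hb : b - (a - p) = q := by rw [← sub_sub_cancel p q, h]; abel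
    simp [hb]

lemma card_differences_sub_mem (A : Finset G) {a : G} (ha : a ∈ A) :
    ((A - A).filter fun x => a - x ∈ A).card = A.card := by
  refine Finset.card_nbij' (fun x => a - x) (fun p => a - p) ?_ ?_ ?_ ?_
  · intro x hx
    simp_all
  · intro p hp
    have hp' : p ∈ A := hp
    simp [hp', Finset.sub_mem_sub ha hp']
  · intro x _
    simp
  · intro x _
    simp

lemma card_filter_piFinset {α : Type*} [DecidableEq α] (n : ℕ) (s : Finset α)
    (p : α → Prop) [DecidablePred p] :
    ((Fintype.piFinset fun _ : Fin n => s).filter fun x => ∀ i, p (x i)).card =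
      (s.filter p).card ^ n := by
  have : ((Fintype.piFinset fun _ : Fin n => s).filter fun x => ∀ i, p (x i)) =
      Fintype.piFinset fun _ : Fin n => s.filter p := by
    ext x
    simp [Fintype.mem_piFinset, forall_and]
  rw [this, Fintype.card_piFinset]
  simp

lemma sum_card_translateInter (A : Finset G) (n : ℕ) :
    ∑ x ∈ Fintype.piFinset (fun _ : Fin n => A - A), ((translateInter A x).card : ℝ) =
      (A.card : ℝ) ^ (n + 1) := by
  simp only [translateInter, Finset.card_filter, Nat.cast_sum]
  rw [Finset.sum_comm]
  have h : ∀ a ∈ A, ∑ x ∈ Fintype.piFinset (fun _ : Fin n => A - A),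
      ((if ∀ i, a - x i ∈ A then 1 else 0 : ℕ) : ℝ) = (A.card : ℝ) ^ n := by
    intro a ha
    rw [← Nat.cast_sum, ← Finset.card_filter,
      card_filter_piFinset n (A - A) (fun y => a - y ∈ A), card_differences_sub_mem A ha]
    push_cast
    rfl
  rw [Finset.sum_congr rfl h, Finset.sum_const, nsmul_eq_mul, pow_succ']

lemma sum_pairs_translateInter (A : Finset G) (n : ℕ) (f : G → G → ℝ) :
    ∑ x ∈ Fintype.piFinset (fun _ : Fin n => A - A),
        ∑ a ∈ translateInter A x, ∑ b ∈ translateInter A x, f a b =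
      ∑ a ∈ A, ∑ b ∈ A,
        f a b * (((A ×ˢ A).filter fun p => p.1 - p.2 = a - b).card : ℝ) ^ n := by
  have h : ∀ x : Fin n → G,
      ∑ a ∈ translateInter A x, ∑ b ∈ translateInter A x, f a b =
        ∑ a ∈ A, ∑ b ∈ A, if ∀ i, a - x i ∈ A ∧ b - x i ∈ A then f a b else 0 := by
    intro x
    rw [translateInter, Finset.sum_filter]
    refine Finset.sum_congr rfl fun a _ => ?_
    by_cases hax : ∀ i, a - x i ∈ A
    · rw [if_pos hax, Finset.sum_filter]
      refine Finset.sum_congr rfl fun b _ => ?_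
      simp [hax]
    · simp [forall_and, hax]
  rw [Finset.sum_congr rfl fun x _ => h x, Finset.sum_comm]
  refine Finset.sum_congr rfl fun a ha => ?_
  rw [Finset.sum_comm]
  refine Finset.sum_congr rfl fun b _ => ?_
  rw [← Finset.sum_filter, Finset.sum_const, nsmul_eq_mul,
    card_filter_piFinset n (A - A) (fun y => a - y ∈ A ∧ b - y ∈ A),
    card_common_differences A b ha, mul_comm]
  push_cast
  rfl

lemma sum_representations_pow_succ (A : Finset G) (n : ℕ) :
    ∑ x ∈ A - A, (((A ×ˢ A).filter fun p => p.1 - p.2 = x).card : ℝ) ^ (n + 1) =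
      ∑ a ∈ A, ∑ b ∈ A, (((A ×ˢ A).filter fun p => p.1 - p.2 = a - b).card : ℝ) ^ n := by
  rw [← Finset.sum_product' A A fun a b =>
      (((A ×ˢ A).filter fun p => p.1 - p.2 = a - b).card : ℝ) ^ n,
    ← Finset.sum_fiberwise_of_maps_to (s := A ×ˢ A) (t := A - A) (g := fun p => p.1 - p.2)
      (fun p hp => Finset.sub_mem_sub (Finset.mem_product.1 hp).1 (Finset.mem_product.1 hp).2)]
  refine Finset.sum_congr rfl fun x _ => ?_
  have h : ∀ q ∈ (A ×ˢ A).filter (fun p => p.1 - p.2 = x),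
      (((A ×ˢ A).filter fun p => p.1 - p.2 = q.1 - q.2).card : ℝ) ^ n =
        (((A ×ˢ A).filter fun p => p.1 - p.2 = x).card : ℝ) ^ n := by
    intro q hq
    rw [(Finset.mem_filter.1 hq).2]
  rw [Finset.sum_congr rfl h, Finset.sum_const, nsmul_eq_mul, pow_succ']

end DifferenceTuples

/-- The extended Pre-BSG lemma. -/
theorem extended_pre_BSG {G : Type*} [AddCommGroup G] [DecidableEq G]
    (A : Finset G) (hA : A.Nonempty) (k : ℕ) (hk : 2 ≤ k)
    (c : ℝ) (hc : 0 < c) (κ : ℝ) (hκ : 0 < κ)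
    (hκdef : ∑ x ∈ A - A, (((A ×ˢ A).filter fun p => p.1 - p.2 = x).card : ℝ) ^ k =
      κ * (A.card : ℝ) ^ (k+1)) :
    ∃ A' ⊆ A,
      (∑ a ∈ A', ∑ b ∈ A',
          Set.indicator
            {x : G | (((A ×ˢ A).filter fun p => p.1 - p.2 = x).card : ℝ) ≤
              c * κ ^ ((1:ℝ)/((k:ℝ)-1)) * (A.card : ℝ)}
            1 (a - b)) ≤
        2 * c ^ (k-1) * (A'.card : ℝ) ^ 2 ∧
      κ * (A.card : ℝ) ≤ 2 * (A'.card : ℝ) := by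
  obtain ⟨n, rfl⟩ : ∃ n, k = n + 1 := ⟨k - 1, by omega⟩
  have hn : n ≠ 0 := by omega
  set S : Set G := {x : G | (((A ×ˢ A).filter fun p => p.1 - p.2 = x).card : ℝ) ≤
    c * κ ^ ((1:ℝ)/(((n + 1 : ℕ) : ℝ)-1)) * (A.card : ℝ)}
  have hA0 : (0 : ℝ) < A.card := by exact_mod_cast hA.card_pos
  rw [Nat.add_sub_cancel]
  have hcn : 0 < c ^ n := pow_pos hc n
  have hpow : (c * κ ^ ((1:ℝ)/(((n + 1 : ℕ) : ℝ)-1)) * (A.card : ℝ)) ^ n =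
      c ^ n * κ * (A.card : ℝ) ^ n := by
    rw [mul_pow, mul_pow]
    congr 2
    rw [show ((n + 1 : ℕ) : ℝ) - 1 = n by push_cast; ring, one_div,
      Real.rpow_inv_natCast_pow hκ.le hn]
  have hbad : ∑ x ∈ Fintype.piFinset (fun _ : Fin n => A - A),
      ∑ a ∈ translateInter A x, ∑ b ∈ translateInter A x, S.indicator (1 : G → ℝ) (a - b) ≤
        c ^ n * (κ * (A.card : ℝ) ^ (n + 1 + 1)) := by
    rw [sum_pairs_translateInter A n fun a b => S.indicator (1 : G → ℝ) (a - b)]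
    calc _ ≤ ∑ _a ∈ A, ∑ _b ∈ A, c ^ n * κ * (A.card : ℝ) ^ n := by
          refine Finset.sum_le_sum fun a _ => Finset.sum_le_sum fun b _ => ?_
          by_cases hab : a - b ∈ S
          · rw [Set.indicator_of_mem hab, Pi.one_apply, one_mul, ← hpow]
            exact pow_le_pow_left₀ (Nat.cast_nonneg _) hab n
          · rw [Set.indicator_of_notMem hab, zero_mul]
            positivity
      _ = _ := by
          simp only [Finset.sum_const, nsmul_eq_mul]
          ring
  have hsq : ∑ x ∈ Fintype.piFinset (fun _ : Fin n => A - A),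
      ((translateInter A x).card : ℝ) ^ 2 = κ * (A.card : ℝ) ^ (n + 1 + 1) := by
    rw [← hκdef, sum_representations_pow_succ]
    have h := sum_pairs_translateInter A n fun _ _ => 1
    simp only [one_mul] at h
    rw [← h]
    refine Finset.sum_congr rfl fun x _ => ?_
    simp [sq]
  by_contra! hcon
  have hlt : ∀ x : Fin n → G, (translateInter A x).Nonempty →
      ((translateInter A x).card : ℝ) ^ 2 <
        κ * A.card / 2 * (translateInter A x).card + (2 * c ^ n)⁻¹ *
          ∑ a ∈ translateInter A x, ∑ b ∈ translateInter A x,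
            S.indicator (1 : G → ℝ) (a - b) := by
    intro x hx
    have hpos : (0 : ℝ) < (translateInter A x).card := by exact_mod_cast hx.card_pos
    have hB : 0 ≤ ∑ a ∈ translateInter A x, ∑ b ∈ translateInter A x,
        S.indicator (1 : G → ℝ) (a - b) :=
      Finset.sum_nonneg fun a _ => Finset.sum_nonneg fun b _ =>
        Set.indicator_nonneg (fun _ _ => zero_le_one) _
    by_cases hle : ∑ a ∈ translateInter A x, ∑ b ∈ translateInter A x,
        S.indicator (1 : G → ℝ) (a - b) ≤ 2 * c ^ n * ((translateInter A x).card : ℝ) ^ 2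
    · have h := hcon _ (Finset.filter_subset _ _) hle
      have h2 : 0 ≤ (2 * c ^ n)⁻¹ * ∑ a ∈ translateInter A x, ∑ b ∈ translateInter A x,
        S.indicator (1 : G → ℝ) (a - b) := mul_nonneg (by positivity) hB
      change 2 * ((translateInter A x).card : ℝ) < _ at h
      nlinarith
    · have h := (lt_inv_mul_iff₀ (by positivity : 0 < 2 * c ^ n)).2 (not_le.1 hle)
      have h2 : 0 < κ * A.card / 2 * ((translateInter A x).card : ℝ) := by positivity
      linarith
  have hsum := Finset.sum_lt_sum (s := Fintype.piFinset fun _ : Fin n => A - A)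
    (f := fun x => ((translateInter A x).card : ℝ) ^ 2)
    (g := fun x => κ * A.card / 2 * (translateInter A x).card + (2 * c ^ n)⁻¹ *
          ∑ a ∈ translateInter A x, ∑ b ∈ translateInter A x,
            S.indicator (1 : G → ℝ) (a - b))
    (fun x _ => by
      rcases (translateInter A x).eq_empty_or_nonempty with h | h
      · simp [h]
      · exact (hlt x h).le)
    ⟨0, by simpa [Fintype.mem_piFinset] using fun _ : Fin n => hA.zero_mem_sub, hlt 0 (by
      have h : translateInter A (0 : Fin n → G) = A :=
        Finset.filter_true_of_mem fun a ha _ => by simpa using ha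
      rwa [h])⟩
  rw [hsq, Finset.sum_add_distrib, ← Finset.mul_sum, ← Finset.mul_sum,
    sum_card_translateInter] at hsum
  have h := mul_le_mul_of_nonneg_left hbad (by positivity : 0 ≤ (2 * c ^ n)⁻¹)
  have h2 : (2 * c ^ n)⁻¹ * (c ^ n * (κ * (A.card : ℝ) ^ (n + 1 + 1))) =
      κ * (A.card : ℝ) ^ (n + 1 + 1) / 2 := by
    field_simp
  have h3 : κ * A.card / 2 * (A.card : ℝ) ^ (n + 1) = κ * (A.card : ℝ) ^ (n + 1 + 1) / 2 := by
    ring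
  linarith
end

section
/- There is an absolute constant C ≥ 1 such that the following holds. Let F be a finite field with q elements, n ≥ 1, and let A, B ⊆ 𝔽_q^n be nonempty with |A| ≥ 2^{−d}·q^n and |B| ≥ 2^{−k}·q^n for some reals d, k ≥ 1. Let f : 𝔽_q^n → [0, 1] and let ε be a real with 2^{−d} ≤ ε ≤ 1. Then there exists an F-linear subspace V of 𝔽_q^n with codimension at most C·k·d³/ε² such that for every v ∈ V and every x ∈ 𝔽_q^n, |E_{a∈A} E_{b∈B} f(x + v + a + b) − E_{a∈A} E_{b∈B} f(x + a + b)| ≤ ε. -/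
section Hoeffding

variable {ι : Type*}

/-- The exponential lies below its chord on `[-1, 1]`. -/
lemma exp_mul_le_cosh_add_mul_sinh (c z : ℝ) (hz : |z| ≤ 1) :
    Real.exp (c * z) ≤ Real.cosh c + z * Real.sinh c := by
  obtain ⟨h1, h2⟩ := abs_le.1 hz
  have h := convexOn_exp.2 (Set.mem_univ c) (Set.mem_univ (-c))
    (show 0 ≤ (1 + z) / 2 by linarith) (show 0 ≤ (1 - z) / 2 by linarith) (by ring)
  simp only [smul_eq_mul] at h
  have e : (1 + z) / 2 * c + (1 - z) / 2 * -c = c * z := by ring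
  rw [e] at h
  refine h.trans (le_of_eq ?_)
  rw [Real.cosh_eq, Real.sinh_eq]
  ring

/-- **Hoeffding's lemma** for the uniform distribution on a finite set. -/
lemma sum_exp_mul_le_card_mul_exp (s : Finset ι) (z : ι → ℝ) (hz : ∀ i ∈ s, |z i| ≤ 1)
    (hsum : ∑ i ∈ s, z i = 0) (c : ℝ) :
    ∑ i ∈ s, Real.exp (c * z i) ≤ s.card * Real.exp (c ^ 2 / 2) := by
  calc ∑ i ∈ s, Real.exp (c * z i) ≤ ∑ i ∈ s, (Real.cosh c + z i * Real.sinh c) :=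
        Finset.sum_le_sum fun i hi => exp_mul_le_cosh_add_mul_sinh c _ (hz i hi)
    _ = s.card * Real.cosh c := by
        rw [Finset.sum_add_distrib, ← Finset.sum_mul, hsum]
        simp
    _ ≤ _ := by gcongr; exact Real.cosh_le_exp_half_sq c

/-- Jensen's inequality for the exponential and the uniform distribution on a finite set. -/
lemma exp_sum_div_card_le (s : Finset ι) (hs : s.Nonempty) (u : ι → ℝ) :
    Real.exp ((∑ i ∈ s, u i) / s.card) ≤ (∑ i ∈ s, Real.exp (u i)) / s.card := by
  have hc : (s.card : ℝ) ≠ 0 := by exact_mod_cast hs.card_pos.ne'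
  have h := convexOn_exp.map_sum_le (t := s) (w := fun _ => (s.card : ℝ)⁻¹) (p := u)
    (fun _ _ => by positivity) (by simp [hc]) (fun _ _ => Set.mem_univ _)
  simpa [← Finset.mul_sum, div_eq_inv_mul] using h

end Hoeffding

section ShiftAverage

variable {G : Type*} [AddCommGroup G]

/-- The average of the translates of `u` by the elements of `S`. -/
noncomputable def shiftAvg (S : Finset G) (u : G → ℝ) (x : G) : ℝ :=
  (∑ t ∈ S, u (x + t)) / S.card

lemma abs_shiftAvg_sub_le {S : Finset G} (hS : S.Nonempty) {u : G → ℝ} {x : G} {c η : ℝ}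
    (h : ∀ t ∈ S, |u (x + t) - c| ≤ η) : |shiftAvg S u x - c| ≤ η := by
  have hc : (0 : ℝ) < S.card := by exact_mod_cast hS.card_pos
  have e : shiftAvg S u x - c = (∑ t ∈ S, (u (x + t) - c)) / S.card := by
    rw [shiftAvg, Finset.sum_sub_distrib]
    field_simp
    simp
  rw [e, abs_div, abs_of_pos hc, div_le_iff₀ hc]
  refine (Finset.abs_sum_le_sum_abs _ _).trans ((Finset.sum_le_sum h).trans ?_)
  simp [mul_comm]

lemma shiftAvg_comm (S T : Finset G) (u : G → ℝ) :
    shiftAvg S (shiftAvg T u) = shiftAvg T (shiftAvg S u) := by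
  ext x
  simp only [shiftAvg, ← Finset.sum_div]
  rw [Finset.sum_comm, div_right_comm]
  simp only [add_right_comm]

/-- Iterated averaging over approximate periods moves a function by little. -/
lemma abs_iterate_shiftAvg_sub_le {S : Finset G} (hS : S.Nonempty) {u : G → ℝ} {η : ℝ}
    (h : ∀ t ∈ S, ∀ x, |u (x + t) - u x| ≤ η) (l : ℕ) (x : G) :
    |(shiftAvg S)^[l] u x - u x| ≤ l * η := by
  induction l generalizing x with
  | zero => simp
  | succ l ih =>
    rw [Function.iterate_succ_apply']
    refine abs_shiftAvg_sub_le hS fun t ht => ?_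
    refine (abs_sub_le _ (u (x + t)) _).trans ?_
    push_cast
    linarith [ih (x + t), h t ht x]

lemma shiftAvg_mem_Icc {S : Finset G} (hS : S.Nonempty) {u : G → ℝ}
    (h : ∀ x, u x ∈ Set.Icc (0 : ℝ) 1) (x : G) : shiftAvg S u x ∈ Set.Icc (0 : ℝ) 1 := by
  have hc : (0 : ℝ) < S.card := by exact_mod_cast hS.card_pos
  refine ⟨div_nonneg (Finset.sum_nonneg fun t _ => (h _).1) hc.le, ?_⟩
  rw [shiftAvg, div_le_one hc]
  simpa using Finset.sum_le_sum (fun t (_ : t ∈ S) => (h (x + t)).2)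

variable [Fintype G]

/-- Exponential moment bound for the deviation of an empirical average of translates. -/
lemma sum_piFinset_sum_exp_le {A : Finset G} (hA : A.Nonempty) {f : G → ℝ}
    (hf : ∀ x, f x ∈ Set.Icc (0 : ℝ) 1) (m : ℕ) (c : ℝ) :
    ∑ a ∈ Fintype.piFinset (fun _ : Fin m => A),
        ∑ y, Real.exp (c * ∑ i, (f (y + a i) - shiftAvg A f y)) ≤
      Fintype.card G * ((A.card : ℝ) ^ m * Real.exp (m * c ^ 2 / 2)) := by
  have hc : (A.card : ℝ) ≠ 0 := by exact_mod_cast hA.card_pos.ne'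
  rw [Finset.sum_comm, ← nsmul_eq_mul, Fintype.card, ← Finset.sum_const]
  refine Finset.sum_le_sum fun y _ => ?_
  simp only [Finset.mul_sum, Real.exp_sum]
  rw [← Finset.sum_pow' A (fun t => Real.exp (c * (f (y + t) - shiftAvg A f y))) m]
  have e : Real.exp (m * c ^ 2 / 2) = Real.exp (c ^ 2 / 2) ^ m := by
    rw [← Real.exp_nat_mul, mul_div_assoc]
  rw [e, ← mul_pow]
  refine pow_le_pow_left₀ (Finset.sum_nonneg fun _ _ => (Real.exp_pos _).le) ?_ m
  refine sum_exp_mul_le_card_mul_exp A _ (fun t _ => ?_) ?_ c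
  · have h1 := hf (y + t)
    have h2 := shiftAvg_mem_Icc hA hf y
    rw [abs_le]
    constructor <;> linarith [h1.1, h1.2, h2.1, h2.2]
  · rw [Finset.sum_sub_distrib, Finset.sum_const, nsmul_eq_mul, shiftAvg]
    field_simp
    simp

open Classical in
/-- Most tuples of elements of `A` give an empirical average uniformly close to
`shiftAvg A (shiftAvg B f)`. -/
lemma card_pow_le_two_mul_card_filter {A B : Finset G} (hA : A.Nonempty) (hB : B.Nonempty)
    {f : G → ℝ} (hf : ∀ x, f x ∈ Set.Icc (0 : ℝ) 1) (m : ℕ) {δ : ℝ} (hδ : 0 < δ)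
    (hm : 4 * (Fintype.card G : ℝ) ≤ B.card * Real.exp (m * δ ^ 2 / 2)) :
    (A.card : ℝ) ^ m ≤ 2 * ((Fintype.piFinset (fun _ : Fin m => A)).filter fun a =>
      ∀ x, |∑ i, (shiftAvg B f (x + a i) - shiftAvg A (shiftAvg B f) x)| ≤ m * δ).card := by
  set g := shiftAvg A f with hg
  set P := Fintype.piFinset (fun _ : Fin m => A) with hP
  set N : ℝ := (Fintype.card G : ℝ) with hN
  set E := Real.exp (m * δ ^ 2 / 2) with hE
  have hNpos : 0 < N := by rw [hN]; exact_mod_cast Fintype.card_pos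
  have hEpos : 0 < E := Real.exp_pos _
  have hBpos : (0 : ℝ) < B.card := by exact_mod_cast hB.card_pos
  have hPcard : (P.card : ℝ) = (A.card : ℝ) ^ m := by
    rw [hP, Fintype.card_piFinset_const]; push_cast; rfl
  let D : (Fin m → G) → G → ℝ := fun a y => ∑ i, (f (y + a i) - g y)
  let S : (Fin m → G) → ℝ := fun a =>
    ∑ y, Real.exp (δ * D a y) + ∑ y, Real.exp ((-δ) * D a y)
  have hS0 : ∀ a, 0 ≤ S a := fun a => by positivity
  have hSsum : ∑ a ∈ P, S a ≤ 2 * (N * ((A.card : ℝ) ^ m * E)) := by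
    have h1 := sum_piFinset_sum_exp_le hA hf m δ
    have h2 := sum_piFinset_sum_exp_le hA hf m (-δ)
    rw [neg_sq] at h2
    rw [Finset.sum_add_distrib]
    linarith
  have hmarkov : 4 * N * E * ((P.filter fun a => ¬ S a ≤ 4 * N * E).card : ℝ) ≤ ∑ a ∈ P, S a := by
    calc 4 * N * E * ((P.filter fun a => ¬ S a ≤ 4 * N * E).card : ℝ)
        = ∑ a ∈ P.filter (fun a => ¬ S a ≤ 4 * N * E), 4 * N * E := by simp [mul_comm]
      _ ≤ ∑ a ∈ P.filter (fun a => ¬ S a ≤ 4 * N * E), S a :=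
          Finset.sum_le_sum fun a ha => (not_le.1 (Finset.mem_filter.1 ha).2).le
      _ ≤ _ := Finset.sum_le_sum_of_subset_of_nonneg (Finset.filter_subset _ _)
          fun a _ _ => hS0 a
  have hbad : 2 * ((P.filter fun a => ¬ S a ≤ 4 * N * E).card : ℝ) ≤ (A.card : ℝ) ^ m := by
    have h := hmarkov.trans hSsum
    have hNE : 0 < 2 * (N * E) := by positivity
    refine le_of_mul_le_mul_left ?_ hNE
    linarith
  have hsplit := Finset.card_filter_add_card_filter_not (s := P) (fun a => S a ≤ 4 * N * E)
  have hgood : (A.card : ℝ) ^ m ≤ 2 * ((P.filter fun a => S a ≤ 4 * N * E).card : ℝ) := by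
    have : ((P.filter fun a => S a ≤ 4 * N * E).card : ℝ) +
        ((P.filter fun a => ¬ S a ≤ 4 * N * E).card : ℝ) = (A.card : ℝ) ^ m := by
      rw [← hPcard]; exact_mod_cast hsplit
    linarith
  refine hgood.trans ?_
  gcongr with a ha
  intro hSa x
  have key : ∑ i, (shiftAvg B f (x + a i) - shiftAvg A (shiftAvg B f) x) =
      (∑ b ∈ B, D a (x + b)) / B.card := by
    rw [shiftAvg_comm A B, ← hg]
    simp only [shiftAvg, D, ← sub_div, ← Finset.sum_sub_distrib, ← Finset.sum_div]
    rw [Finset.sum_comm]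
    simp only [add_right_comm]
  have bound : ∀ c : ℝ, ∑ y, Real.exp (c * D a y) ≤ 4 * N * E →
      c * ((∑ b ∈ B, D a (x + b)) / B.card) ≤ m * δ ^ 2 := by
    intro c hcS
    rw [← Real.exp_le_exp, ← mul_div_assoc, Finset.mul_sum]
    refine (exp_sum_div_card_le B hB _).trans ?_
    rw [div_le_iff₀ hBpos]
    have h1 : ∑ b ∈ B, Real.exp (c * D a (x + b)) ≤ ∑ y, Real.exp (c * D a y) := by
      rw [← Equiv.sum_comp (Equiv.addLeft x)]
      exact Finset.sum_le_sum_of_subset_of_nonneg (Finset.subset_univ _)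
        fun _ _ _ => (Real.exp_pos _).le
    have h2 : Real.exp (m * δ ^ 2) = E * E := by rw [hE, ← Real.exp_add]; ring_nf
    rw [h2]
    refine (h1.trans hcS).trans ?_
    nlinarith [mul_le_mul_of_nonneg_right hm hEpos.le]
  have hp : 0 ≤ ∑ y, Real.exp (δ * D a y) := by positivity
  have hn : 0 ≤ ∑ y, Real.exp ((-δ) * D a y) := by positivity
  have hSa' : ∑ y, Real.exp (δ * D a y) + ∑ y, Real.exp ((-δ) * D a y) ≤ 4 * N * E := hSa
  have b1 := bound δ (by linarith)
  have b2 := bound (-δ) (by linarith)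
  rw [key, abs_le]
  constructor
  · refine le_of_mul_le_mul_left ?_ hδ
    linarith
  · refine le_of_mul_le_mul_left ?_ hδ
    linarith

open Classical in
/-- Some translate of the diagonal meets a given set of tuples in at least its fair share. -/
lemma exists_card_mul_card_le_card_diagonal (m : ℕ) (L : Finset (Fin m → G)) :
    ∃ s : Fin m → G, Fintype.card G * L.card ≤
      (Finset.univ.filter fun t : G => (fun i => s i + t) ∈ L).card * Fintype.card G ^ m := by
  have hsum : ∑ s : Fin m → G, (Finset.univ.filter fun t : G => (fun i => s i + t) ∈ L).card =
      Fintype.card G * L.card := by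
    simp only [Finset.card_filter]
    rw [Finset.sum_comm, Fintype.card, ← smul_eq_mul, ← Finset.sum_const]
    refine Finset.sum_congr rfl fun t _ => ?_
    have := Equiv.sum_comp (Equiv.addRight (fun _ : Fin m => t)) fun s => if s ∈ L then 1 else 0
    exact this.trans (by simp)
  by_contra! h
  have h2 := Finset.sum_lt_sum_of_nonempty (Finset.univ_nonempty (α := Fin m → G))
    fun s _ => h s
  rw [← Finset.sum_mul, hsum] at h2
  simp [mul_comm] at h2

/-- **Almost periodicity**: `shiftAvg A (shiftAvg B f)` has a large set of uniform almost
periods. -/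
lemma exists_almost_periods_s18 {A B : Finset G} (hA : A.Nonempty) (hB : B.Nonempty)
    {f : G → ℝ} (hf : ∀ x, f x ∈ Set.Icc (0 : ℝ) 1) {m : ℕ} (hm0 : 0 < m) {δ : ℝ} (hδ : 0 < δ)
    (hm : 4 * (Fintype.card G : ℝ) ≤ B.card * Real.exp (m * δ ^ 2 / 2)) :
    ∃ X : Finset G, X.Nonempty ∧
      Fintype.card G * (A.card : ℝ) ^ m ≤ 2 * X.card * (Fintype.card G : ℝ) ^ m ∧
      ∀ t ∈ X, ∀ x, |shiftAvg A (shiftAvg B f) (x + t) - shiftAvg A (shiftAvg B f) x| ≤ 2 * δ := by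
  classical
  set u := shiftAvg B f with hu
  set g := shiftAvg A u with hg
  set L := (Fintype.piFinset (fun _ : Fin m => A)).filter fun a =>
      ∀ x, |∑ i, (u (x + a i) - g x)| ≤ m * δ with hL
  have hLcard : (A.card : ℝ) ^ m ≤ 2 * L.card := by
    convert card_pow_le_two_mul_card_filter hA hB hf m hδ hm
  obtain ⟨s, hs⟩ := exists_card_mul_card_le_card_diagonal m L
  set Y := Finset.univ.filter fun t : G => (fun i => s i + t) ∈ L with hY
  have hs' : (Fintype.card G : ℝ) * L.card ≤ Y.card * (Fintype.card G : ℝ) ^ m := by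
    exact_mod_cast hs
  have hNpos : (0 : ℝ) < Fintype.card G := by exact_mod_cast Fintype.card_pos
  have hApos : (0 : ℝ) < A.card := by exact_mod_cast hA.card_pos
  have hbig : Fintype.card G * (A.card : ℝ) ^ m ≤ 2 * Y.card * (Fintype.card G : ℝ) ^ m := by
    nlinarith [mul_le_mul_of_nonneg_left hLcard hNpos.le]
  have hYne : Y.Nonempty := by
    rw [Finset.nonempty_iff_ne_empty]
    intro h
    rw [h] at hbig
    have : 0 < Fintype.card G * (A.card : ℝ) ^ m := by positivity
    simp at hbig
    linarith
  obtain ⟨t₀, ht₀⟩ := hYne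
  have hclose : ∀ t ∈ Y, ∀ x, |∑ i, (u (x + (s i + t)) - g x)| ≤ m * δ := fun t ht =>
    (Finset.mem_filter.1 (Finset.mem_filter.1 ht).2).2
  refine ⟨Y.image (· - t₀), ⟨_, Finset.mem_image_of_mem _ ht₀⟩, ?_, ?_⟩
  · rwa [Finset.card_image_of_injective _ (sub_left_injective)]
  · intro t' ht' x
    obtain ⟨t, ht, rfl⟩ := Finset.mem_image.1 ht'
    have h1 := hclose t ht x
    have h2 := hclose t₀ ht₀ (x + (t - t₀))
    have e : ∀ i, x + (t - t₀) + (s i + t₀) = x + (s i + t) := fun i => by abel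
    simp only [e, Finset.sum_sub_distrib, Finset.sum_const, Finset.card_univ, Fintype.card_fin,
      nsmul_eq_mul] at h1 h2
    have hmpos : (0 : ℝ) < m := by exact_mod_cast hm0
    rw [abs_le] at h1 h2 ⊢
    constructor
    · refine le_of_mul_le_mul_left ?_ hmpos
      linarith
    · refine le_of_mul_le_mul_left ?_ hmpos
      linarith

end ShiftAverage

section Fourier

variable {F : Type*} [Field F] [Fintype F] {n : ℕ}

/-- The average over `S` of the additive character of frequency `r`. -/
noncomputable def charAvg (ψ : AddChar F ℂ) (S : Finset (Fin n → F)) (r : Fin n → F) : ℂ :=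
  (∑ t ∈ S, ψ (r ⬝ᵥ t)) / S.card

/-- The unnormalised Fourier transform of `u`. -/
noncomputable def charSum (ψ : AddChar F ℂ) (u : (Fin n → F) → ℝ) (r : Fin n → F) : ℂ :=
  ∑ x, (u x : ℂ) * ψ (r ⬝ᵥ x)

lemma norm_charAvg_le_one (ψ : AddChar F ℂ) (S : Finset (Fin n → F)) (r : Fin n → F) :
    ‖charAvg ψ S r‖ ≤ 1 := by
  rw [charAvg, norm_div, Complex.norm_natCast]
  refine div_le_one_of_le₀ ?_ (Nat.cast_nonneg _)
  refine (norm_sum_le _ _).trans ?_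
  simp [AddChar.norm_apply]

lemma sum_addChar_dotProduct [DecidableEq F] {ψ : AddChar F ℂ} (hψ : ψ ≠ 1) (x : Fin n → F) :
    ∑ r : Fin n → F, ψ (r ⬝ᵥ x) = if x = 0 then (Fintype.card F : ℂ) ^ n else 0 := by
  split_ifs with h
  · simp [h]
  · obtain ⟨i, hi⟩ := Function.ne_iff.1 h
    obtain ⟨a, ha⟩ := AddChar.ne_one_iff.1 hψ
    let φ : AddChar (Fin n → F) ℂ :=
      { toFun := fun r => ψ (r ⬝ᵥ x)
        map_zero_eq_one' := by simp
        map_add_eq_mul' := fun r s => by rw [add_dotProduct, AddChar.map_add_eq_mul] }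
    have hφ : φ ≠ 1 := by
      refine AddChar.ne_one_iff.2 ⟨Pi.single i (a / x i), ?_⟩
      change ψ (Pi.single i (a / x i) ⬝ᵥ x) ≠ 1
      rwa [single_dotProduct, div_mul_cancel₀ _ hi]
    exact AddChar.sum_eq_zero_of_ne_one hφ

/-- Fourier inversion. -/
lemma sum_conj_charSum_mul {ψ : AddChar F ℂ} (hψ : ψ ≠ 1) (u : (Fin n → F) → ℝ)
    (y : Fin n → F) :
    ∑ r, (starRingEnd ℂ) (charSum ψ u r) * ψ (r ⬝ᵥ y) = (Fintype.card F : ℂ) ^ n * u y := by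
  classical
  have h : ∀ r x : Fin n → F, (starRingEnd ℂ) ((u x : ℂ) * ψ (r ⬝ᵥ x)) * ψ (r ⬝ᵥ y) =
      u x * ψ (r ⬝ᵥ (y - x)) := by
    intro r x
    rw [map_mul, Complex.conj_ofReal, ← AddChar.map_neg_eq_conj, mul_assoc,
      ← AddChar.map_add_eq_mul, dotProduct_sub, neg_add_eq_sub]
  simp only [charSum, map_sum, Finset.sum_mul, h]
  rw [Finset.sum_comm]
  simp only [← Finset.mul_sum, sum_addChar_dotProduct hψ, sub_eq_zero]
  simp [mul_comm]

/-- Plancherel's identity. -/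
lemma sum_norm_charSum_sq {ψ : AddChar F ℂ} (hψ : ψ ≠ 1) (u : (Fin n → F) → ℝ) :
    ∑ r, ‖charSum ψ u r‖ ^ 2 = (Fintype.card F : ℝ) ^ n * ∑ x, u x ^ 2 := by
  have h : ∑ r, (starRingEnd ℂ) (charSum ψ u r) * charSum ψ u r =
      (Fintype.card F : ℂ) ^ n * ∑ x, (u x : ℂ) ^ 2 := by
    have h1 : ∀ r, (starRingEnd ℂ) (charSum ψ u r) * charSum ψ u r =
        ∑ y, u y * ((starRingEnd ℂ) (charSum ψ u r) * ψ (r ⬝ᵥ y)) := by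
      intro r
      conv_lhs => rw [charSum.eq_1 ψ u r, Finset.mul_sum]
      exact Finset.sum_congr rfl fun y _ => by rw [charSum]; ring
    simp only [h1]
    rw [Finset.sum_comm]
    simp only [← Finset.mul_sum, sum_conj_charSum_mul hψ]
    rw [Finset.mul_sum]
    exact Finset.sum_congr rfl fun y _ => by ring
  simp only [Complex.conj_mul'] at h
  exact_mod_cast h

lemma sum_norm_charAvg_sq {ψ : AddChar F ℂ} (hψ : ψ ≠ 1) {S : Finset (Fin n → F)}
    (hS : S.Nonempty) :
    ∑ r, ‖charAvg ψ S r‖ ^ 2 = (Fintype.card F : ℝ) ^ n / S.card := by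
  classical
  have hc : (S.card : ℝ) ≠ 0 := by exact_mod_cast hS.card_pos.ne'
  have e : ∀ r, charAvg ψ S r = charSum ψ (fun x => if x ∈ S then 1 else 0) r / S.card := by
    intro r
    simp only [charAvg, charSum, apply_ite Complex.ofReal]
    simp
  simp only [e, norm_div, Complex.norm_natCast, div_pow, ← Finset.sum_div,
    sum_norm_charSum_sq hψ]
  simp
  field_simp

/-- Averaging over `S` acts on Fourier coefficients as multiplication by `charAvg ψ S`. -/
lemma shiftAvg_eq_sum_charAvg_mul (ψ : AddChar F ℂ) (S : Finset (Fin n → F))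
    {u : (Fin n → F) → ℝ} {c : (Fin n → F) → ℂ} (h : ∀ x, (u x : ℂ) = ∑ r, c r * ψ (r ⬝ᵥ x))
    (x : Fin n → F) :
    (shiftAvg S u x : ℂ) = ∑ r, c r * charAvg ψ S r * ψ (r ⬝ᵥ x) := by
  simp only [shiftAvg, charAvg]
  push_cast
  simp only [h]
  rw [Finset.sum_comm, Finset.sum_div]
  refine Finset.sum_congr rfl fun r _ => ?_
  simp only [dotProduct_add, AddChar.map_add_eq_mul, ← Finset.mul_sum]
  ring

lemma iterate_shiftAvg_eq_sum_charAvg_pow_mul (ψ : AddChar F ℂ) (S : Finset (Fin n → F))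
    {u : (Fin n → F) → ℝ} {c : (Fin n → F) → ℂ} (h : ∀ x, (u x : ℂ) = ∑ r, c r * ψ (r ⬝ᵥ x))
    (l : ℕ) (x : Fin n → F) :
    ((shiftAvg S)^[l] u x : ℂ) = ∑ r, c r * charAvg ψ S r ^ l * ψ (r ⬝ᵥ x) := by
  induction l generalizing x with
  | zero => simpa using h x
  | succ l ih =>
    rw [Function.iterate_succ_apply', shiftAvg_eq_sum_charAvg_mul ψ S ih]
    simp only [pow_succ, mul_assoc]

/-- After smoothing by `X`, translation by a vector orthogonal to the large spectrum of `X`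
has little effect. -/
lemma abs_iterate_shiftAvg_add_sub_le {ψ : AddChar F ℂ} (hψ : ψ ≠ 1)
    {A B X : Finset (Fin n → F)} (hA : A.Nonempty)
    {f : (Fin n → F) → ℝ} (hf : ∀ x, f x ∈ Set.Icc (0 : ℝ) 1) (l : ℕ) {v : Fin n → F}
    (hv : ∀ r, 1 / 2 ≤ ‖charAvg ψ X r‖ → r ⬝ᵥ v = 0) (x : Fin n → F) :
    |(shiftAvg X)^[l] (shiftAvg A (shiftAvg B f)) (x + v) -
        (shiftAvg X)^[l] (shiftAvg A (shiftAvg B f)) x| ≤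
      2 * (1 / 2) ^ l * √((Fintype.card F : ℝ) ^ n / A.card) := by
  set N : ℝ := (Fintype.card F : ℝ) ^ n with hN
  have hNpos : 0 < N := by rw [hN]; have := Fintype.card_pos (α := F); positivity
  set c : (Fin n → F) → ℂ := fun r => (starRingEnd ℂ) (charSum ψ f r) / N with hc
  have hfc : ∀ x, (f x : ℂ) = ∑ r, c r * ψ (r ⬝ᵥ x) := by
    intro x
    have h := sum_conj_charSum_mul hψ f x
    have hN' : (N : ℂ) ≠ 0 := by exact_mod_cast hNpos.ne'
    have hNc : (N : ℂ) = (Fintype.card F : ℂ) ^ n := by rw [hN]; push_cast; rfl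
    simp only [hc, div_mul_eq_mul_div, ← Finset.sum_div, h, ← hNc]
    field_simp
  have hcnorm : ∑ r, ‖c r‖ ^ 2 ≤ 1 := by
    have h1 : ∀ r, ‖c r‖ ^ 2 = ‖charSum ψ f r‖ ^ 2 / N ^ 2 := by
      intro r
      simp [hc, div_pow]
    have h2 : ∑ x, f x ^ 2 ≤ N := by
      have : ∑ x, f x ^ 2 ≤ ∑ _x : Fin n → F, (1 : ℝ) :=
        Finset.sum_le_sum fun x _ => pow_le_one₀ (hf x).1 (hf x).2
      simpa [hN] using this
    simp only [h1, ← Finset.sum_div, sum_norm_charSum_sq hψ]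
    rw [div_le_one (by positivity), ← hN, sq]
    gcongr
  have hexp := iterate_shiftAvg_eq_sum_charAvg_pow_mul ψ X (shiftAvg_eq_sum_charAvg_mul ψ A
    (shiftAvg_eq_sum_charAvg_mul ψ B hfc)) l
  rw [← Real.norm_eq_abs, ← Complex.norm_real, Complex.ofReal_sub, hexp, hexp,
    ← Finset.sum_sub_distrib]
  have hterm : ∀ r, ‖c r * charAvg ψ B r * charAvg ψ A r * charAvg ψ X r ^ l * ψ (r ⬝ᵥ (x + v)) -
      c r * charAvg ψ B r * charAvg ψ A r * charAvg ψ X r ^ l * ψ (r ⬝ᵥ x)‖ ≤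
      2 * (1 / 2) ^ l * (‖c r‖ * ‖charAvg ψ A r‖) := by
    intro r
    rw [← mul_sub, dotProduct_add]
    by_cases hr : 1 / 2 ≤ ‖charAvg ψ X r‖
    · rw [hv r hr]
      simp
      positivity
    · push Not at hr
      have h1 : ‖ψ (r ⬝ᵥ x + r ⬝ᵥ v) - ψ (r ⬝ᵥ x)‖ ≤ 2 := by
        refine (norm_sub_le _ _).trans ?_
        rw [AddChar.norm_apply, AddChar.norm_apply]
        norm_num
      simp only [norm_mul, norm_pow]
      calc ‖c r‖ * ‖charAvg ψ B r‖ * ‖charAvg ψ A r‖ * ‖charAvg ψ X r‖ ^ l *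
            ‖ψ (r ⬝ᵥ x + r ⬝ᵥ v) - ψ (r ⬝ᵥ x)‖
          ≤ ‖c r‖ * 1 * ‖charAvg ψ A r‖ * (1 / 2) ^ l * 2 := by
            gcongr
            exact norm_charAvg_le_one ψ B r
        _ = _ := by ring
  refine (norm_sum_le _ _).trans ((Finset.sum_le_sum fun r _ => hterm r).trans ?_)
  rw [← Finset.mul_sum]
  gcongr
  refine (Real.sum_mul_le_sqrt_mul_sqrt _ _ _).trans ?_
  rw [sum_norm_charAvg_sq hψ hA]
  calc √(∑ r, ‖c r‖ ^ 2) * √(N / A.card) ≤ 1 * √(N / A.card) := by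
        gcongr
        exact Real.sqrt_le_one.2 hcnorm
    _ = _ := one_mul _

end Fourier

section Chang

/-- A surjective homomorphism of finite groups equidistributes. -/
lemma card_mul_sum_comp_eq {G H : Type*} [AddCommGroup G] [Fintype G] [AddCommGroup H] [Fintype H]
    (φ : G →+ H) (hφ : Function.Surjective φ) (h : H → ℝ) :
    Fintype.card H * ∑ x, h (φ x) = Fintype.card G * ∑ y, h y := by
  have h1 : ∀ y : H, ∑ x, h (φ x + y) = ∑ x, h (φ x) := by
    intro y
    obtain ⟨s, rfl⟩ := hφ y
    simpa using Equiv.sum_comp (Equiv.addRight s) fun x => h (φ x)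
  have h2 : ∀ x : G, ∑ y, h (φ x + y) = ∑ y, h y := fun x =>
    Equiv.sum_comp (Equiv.addLeft (φ x)) h
  calc Fintype.card H * ∑ x, h (φ x) = ∑ y : H, ∑ x, h (φ x + y) := by simp [h1]
    _ = ∑ x, ∑ y, h (φ x + y) := Finset.sum_comm
    _ = _ := by simp [h2]

variable {F : Type*} [Field F] [Fintype F] {n : ℕ}

/-- **Chang's theorem** over a finite field: linearly independent frequencies in the large
spectrum of a dense set are few. -/
lemma card_le_log_of_linearIndependent {ψ : AddChar F ℂ} (hψ : ψ ≠ 1) {X : Finset (Fin n → F)}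
    (hX : X.Nonempty) {D : ℕ} {r : Fin D → Fin n → F} (hr : LinearIndependent F r)
    (hlarge : ∀ i, 1 / 2 ≤ ‖charAvg ψ X (r i)‖) :
    (D : ℝ) ≤ 8 * Real.log ((Fintype.card F : ℝ) ^ n / X.card) := by
  have hXpos : (0 : ℝ) < X.card := by exact_mod_cast hX.card_pos
  have hq : (0 : ℝ) < Fintype.card F := by exact_mod_cast Fintype.card_pos
  have hphase : ∀ i, ∃ c : ℂ, ‖c‖ = 1 ∧ c * charAvg ψ X (r i) = ‖charAvg ψ X (r i)‖ := by
    intro i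
    have hz : charAvg ψ X (r i) ≠ 0 := by
      intro h
      have := hlarge i
      rw [h, norm_zero] at this
      norm_num at this
    have hz' : (‖charAvg ψ X (r i)‖ : ℂ) ≠ 0 := by exact_mod_cast norm_ne_zero_iff.2 hz
    refine ⟨(starRingEnd ℂ) (charAvg ψ X (r i)) / ‖charAvg ψ X (r i)‖, ?_, ?_⟩
    · simp [hz]
    · rw [div_mul_eq_mul_div, Complex.conj_mul', sq]
      field_simp
  choose c hc1 hc2 using hphase
  let h : Fin D → F → ℝ := fun i y => (c i * ψ y).re
  have hbound : ∀ i y, |h i y| ≤ 1 := by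
    intro i y
    refine (Complex.abs_re_le_norm _).trans ?_
    rw [norm_mul, hc1, AddChar.norm_apply, one_mul]
  have hzero : ∀ i, ∑ y, h i y = 0 := by
    intro i
    rw [← Complex.re_sum, ← Finset.mul_sum, AddChar.sum_eq_zero_of_ne_one hψ]
    simp
  have hmean : (D : ℝ) / 2 ≤ (∑ x ∈ X, ∑ i, h i (r i ⬝ᵥ x)) / X.card := by
    have e : (∑ x ∈ X, ∑ i, h i (r i ⬝ᵥ x)) / X.card = ∑ i, ‖charAvg ψ X (r i)‖ := by
      rw [Finset.sum_comm, Finset.sum_div]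
      refine Finset.sum_congr rfl fun i _ => ?_
      have h2 := congrArg Complex.re (hc2 i)
      rw [Complex.ofReal_re] at h2
      rw [← h2, charAvg, ← mul_div_assoc, Finset.mul_sum, Complex.div_natCast_re, Complex.re_sum]
    rw [e]
    calc (D : ℝ) / 2 = ∑ _i : Fin D, (1 / 2 : ℝ) := by simp [div_eq_mul_inv]
      _ ≤ _ := Finset.sum_le_sum fun i _ => hlarge i
  let φ : (Fin n → F) →ₗ[F] (Fin D → F) := Matrix.mulVecLin (Matrix.of r)
  have hφ : Function.Surjective φ := by
    rw [← LinearMap.range_eq_top]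
    apply Submodule.eq_top_of_finrank_eq
    have : (Matrix.of r).rank = Fintype.card (Fin D) := LinearIndependent.rank_matrix hr
    simpa [Matrix.rank] using this
  have hall : ∑ x : Fin n → F, Real.exp (1 / 2 * ∑ i, h i (r i ⬝ᵥ x)) ≤
      (Fintype.card F : ℝ) ^ n * Real.exp (D / 8) := by
    have h1 := card_mul_sum_comp_eq φ.toAddMonoidHom hφ
      fun y => Real.exp (1 / 2 * ∑ i, h i (y i))
    have h2 : ∑ y : Fin D → F, Real.exp (1 / 2 * ∑ i, h i (y i)) ≤
        (Fintype.card F : ℝ) ^ D * Real.exp (D / 8) := by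
      simp only [Finset.mul_sum, Real.exp_sum]
      rw [← Fintype.prod_sum (fun i y => Real.exp (1 / 2 * h i y))]
      calc ∏ i : Fin D, ∑ y, Real.exp (1 / 2 * h i y)
          ≤ ∏ _i : Fin D, ((Fintype.card F : ℝ) * Real.exp ((1 / 2) ^ 2 / 2)) :=
            Finset.prod_le_prod (fun _ _ => Finset.sum_nonneg fun _ _ => (Real.exp_pos _).le)
              fun i _ => sum_exp_mul_le_card_mul_exp Finset.univ _ (fun y _ => hbound i y)
                (hzero i) _
        _ = _ := by
            simp only [Finset.prod_const, Finset.card_univ, Fintype.card_fin, mul_pow,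
              ← Real.exp_nat_mul]
            ring_nf
    have h3 : (Fintype.card F : ℝ) ^ D * ∑ x : Fin n → F, Real.exp (1 / 2 * ∑ i, h i (r i ⬝ᵥ x)) =
        (Fintype.card F : ℝ) ^ n * ∑ y : Fin D → F, Real.exp (1 / 2 * ∑ i, h i (y i)) := by
      have hφr : ∀ x i, φ x i = r i ⬝ᵥ x := fun _ _ => rfl
      simpa [hφr] using h1
    have hqD : 0 < (Fintype.card F : ℝ) ^ D := by positivity
    refine le_of_mul_le_mul_left ?_ hqD
    rw [h3]
    calc _ ≤ (Fintype.card F : ℝ) ^ n * ((Fintype.card F : ℝ) ^ D * Real.exp (D / 8)) := by gcongr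
      _ = _ := by ring
  have hexp : Real.exp (D / 4) ≤
      (Fintype.card F : ℝ) ^ n / X.card * Real.exp (D / 8) := by
    calc Real.exp (D / 4)
        ≤ Real.exp ((∑ x ∈ X, 1 / 2 * ∑ i, h i (r i ⬝ᵥ x)) / X.card) := by
          rw [Real.exp_le_exp, ← Finset.mul_sum, mul_div_assoc]
          linarith
      _ ≤ (∑ x ∈ X, Real.exp (1 / 2 * ∑ i, h i (r i ⬝ᵥ x))) / X.card :=
          exp_sum_div_card_le X hX _
      _ ≤ ((Fintype.card F : ℝ) ^ n * Real.exp (D / 8)) / X.card := by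
          gcongr
          exact (Finset.sum_le_sum_of_subset_of_nonneg (Finset.subset_univ _)
            fun _ _ _ => (Real.exp_pos _).le).trans hall
      _ = _ := by ring
  have hlog := Real.log_le_log (Real.exp_pos _) hexp
  rw [Real.log_mul (by positivity) (Real.exp_pos _).ne', Real.log_exp, Real.log_exp] at hlog
  linarith

/-- The annihilator of the large spectrum of a dense set has small codimension. -/
lemma exists_submodule_orthogonal_spectrum {ψ : AddChar F ℂ} (hψ : ψ ≠ 1)
    {X : Finset (Fin n → F)} (hX : X.Nonempty) :
    ∃ V : Submodule F (Fin n → F),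
      (n : ℝ) - Module.finrank F V ≤ 8 * Real.log ((Fintype.card F : ℝ) ^ n / X.card) ∧
      ∀ v ∈ V, ∀ r, 1 / 2 ≤ ‖charAvg ψ X r‖ → r ⬝ᵥ v = 0 := by
  obtain ⟨r, hrmem, hrspan, hrind⟩ :=
    Submodule.exists_fun_fin_finrank_span_eq F {r | 1 / 2 ≤ ‖charAvg ψ X r‖}
  let φ := Matrix.mulVecLin (Matrix.of r)
  refine ⟨LinearMap.ker φ, ?_, ?_⟩
  · refine le_trans ?_ (card_le_log_of_linearIndependent hψ hX hrind hrmem)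
    have h1 := LinearMap.finrank_range_add_finrank_ker φ
    have h2 := Submodule.finrank_le (LinearMap.range φ)
    simp only [Module.finrank_fin_fun] at h1 h2
    rw [sub_le_iff_le_add]
    exact_mod_cast (by omega : n ≤ _ + Module.finrank F (LinearMap.ker φ))
  · intro v hv s hs
    have hs' : s ∈ Submodule.span F (Set.range r) := by
      rw [hrspan]
      exact Submodule.subset_span hs
    clear hs
    induction hs' using Submodule.span_induction with
    | mem x hx =>
      obtain ⟨i, rfl⟩ := hx
      exact congrFun (LinearMap.mem_ker.1 hv) i
    | zero => simp
    | add x y _ _ hx hy => rw [add_dotProduct, hx, hy, add_zero]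
    | smul a x _ hx => rw [smul_dotProduct, hx, smul_zero]

end Chang

/-- Sanders' invariance lemma over `𝔽_q^n`. -/
theorem sanders_invariance :
    ∃ C : ℝ, 1 ≤ C ∧ ∀ (F : Type) [Field F] [Fintype F] [DecidableEq F] (n : ℕ), 1 ≤ n →
      ∀ (A B : Finset (Fin n → F)), A.Nonempty → B.Nonempty →
      ∀ d k : ℝ, 1 ≤ d → 1 ≤ k →
      (2:ℝ) ^ (-d) * (Fintype.card F : ℝ) ^ n ≤ A.card →
      (2:ℝ) ^ (-k) * (Fintype.card F : ℝ) ^ n ≤ B.card →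
      ∀ f : (Fin n → F) → ℝ, (∀ x, f x ∈ Set.Icc (0:ℝ) 1) →
      ∀ ε : ℝ, (2:ℝ) ^ (-d) ≤ ε → ε ≤ 1 →
      ∃ V : Submodule F (Fin n → F),
        ((n:ℝ) - Module.finrank F V) ≤ C * k * d ^ 3 / ε ^ 2 ∧
        ∀ v ∈ V, ∀ x : Fin n → F,
          |(∑ a ∈ A, ∑ b ∈ B, f (x + v + a + b)) / ((A.card : ℝ) * (B.card : ℝ)) -
            (∑ a ∈ A, ∑ b ∈ B, f (x + a + b)) / ((A.card : ℝ) * (B.card : ℝ))| ≤ ε := by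
  refine ⟨200000, by norm_num, ?_⟩
  intro F _ _ _ n _ A B hA hB d k hd hk hAd hBk f hf ε hε hε1
  obtain ⟨ψ, hψ⟩ : ∃ ψ : AddChar F ℂ, ψ ≠ 1 := by
    refine ⟨AddChar.FiniteField.primitiveChar_to_Complex F, ?_⟩
    have h := AddChar.FiniteField.primitiveChar_to_Complex_isPrimitive F (one_ne_zero (α := F))
    rwa [AddChar.mulShift_one] at h
  set N : ℝ := (Fintype.card F : ℝ) ^ n with hN
  have hNpos : 0 < N := by
    have : (0 : ℝ) < Fintype.card F := by exact_mod_cast Fintype.card_pos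
    positivity
  have hcardN : (Fintype.card (Fin n → F) : ℝ) = N := by simp [hN]
  have hApos : (0 : ℝ) < A.card := by exact_mod_cast hA.card_pos
  have hBpos : (0 : ℝ) < B.card := by exact_mod_cast hB.card_pos
  have hε0 : 0 < ε := lt_of_lt_of_le (by positivity) hε
  have hlog2 : Real.log 2 ≤ 1 := by linarith [Real.log_two_lt_d9]
  have hNA : N / A.card ≤ (2 : ℝ) ^ d := by
    rw [div_le_iff₀ hApos]
    calc N = (2 : ℝ) ^ d * ((2 : ℝ) ^ (-d) * N) := by
          rw [← mul_assoc, ← Real.rpow_add two_pos]; simp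
      _ ≤ _ := by gcongr
  have hNB : N ≤ B.card * (2 : ℝ) ^ k := by
    calc N = (2 : ℝ) ^ (-k) * N * (2 : ℝ) ^ k := by
          rw [mul_right_comm, ← Real.rpow_add two_pos]; simp
      _ ≤ _ := by gcongr
  set l := ⌈4 * d⌉₊
  have hl1 : 4 * d ≤ l := Nat.le_ceil _
  have hl2 : (l : ℝ) ≤ 5 * d := by
    have := (Nat.ceil_lt_add_one (show 0 ≤ 4 * d by linarith)).le
    linarith
  have hlpos : (0 : ℝ) < l := by linarith
  set δ := ε / (8 * l) with hδ
  have hδpos : 0 < δ := by positivity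
  have hδ1 : δ ≤ 1 := by
    rw [hδ, div_le_one (by positivity)]
    linarith
  have hδinv : 1 / δ ^ 2 ≤ 1600 * d ^ 2 / ε ^ 2 := by
    have e : 1 / δ ^ 2 = 64 * (l : ℝ) ^ 2 / ε ^ 2 := by
      rw [hδ]; field_simp; norm_num
    rw [e]
    gcongr ?_ / _
    nlinarith
  set m := ⌈2 * (k + 2) / δ ^ 2⌉₊
  have hm1 : 2 * (k + 2) / δ ^ 2 ≤ m := Nat.le_ceil _
  have hmpos : 0 < m := Nat.ceil_pos.2 (by positivity)
  have hm2 : (m : ℝ) ≤ 7 * k * (1 / δ ^ 2) := by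
    have h1 : (m : ℝ) ≤ _ := (Nat.ceil_lt_add_one (show 0 ≤ 2 * (k + 2) / δ ^ 2 by positivity)).le
    have h2 : 1 ≤ 1 / δ ^ 2 := by
      rw [le_div_iff₀ (by positivity), one_mul]
      exact pow_le_one₀ hδpos.le hδ1
    have h3 : 2 * (k + 2) / δ ^ 2 = 2 * (k + 2) * (1 / δ ^ 2) := by ring
    rw [h3] at h1
    nlinarith [mul_nonneg (sub_nonneg.2 hk) (zero_le_one.trans h2)]
  have hsample : 4 * (Fintype.card (Fin n → F) : ℝ) ≤ B.card * Real.exp (m * δ ^ 2 / 2) := by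
    rw [hcardN]
    have h1 : k + 2 ≤ m * δ ^ 2 / 2 := by
      rw [div_le_iff₀ (by positivity)] at hm1
      linarith
    have h2 : 4 * (2 : ℝ) ^ k ≤ Real.exp (m * δ ^ 2 / 2) := by
      have e : 4 * (2 : ℝ) ^ k = Real.exp (Real.log 2 * (k + 2)) := by
        rw [← Real.rpow_def_of_pos two_pos, Real.rpow_add two_pos]
        norm_num
        ring
      rw [e, Real.exp_le_exp]
      nlinarith
    calc 4 * N ≤ 4 * (B.card * (2 : ℝ) ^ k) := by gcongr
      _ = B.card * (4 * (2 : ℝ) ^ k) := by ring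
      _ ≤ _ := by gcongr
  obtain ⟨X, hX, hXcard, hper⟩ := exists_almost_periods_s18 hA hB hf hmpos hδpos hsample
  have hXpos : (0 : ℝ) < X.card := by exact_mod_cast hX.card_pos
  rw [hcardN] at hXcard
  have hXdens : Real.log (N / X.card) ≤ 2 * (d * m) := by
    have h1 : N / X.card ≤ 2 * (N / A.card) ^ m := by
      rw [div_pow, div_le_iff₀ hXpos, ← mul_div_assoc, div_mul_eq_mul_div,
        le_div_iff₀ (by positivity)]
      linarith
    have h2 : N / X.card ≤ 2 * ((2 : ℝ) ^ d) ^ m := h1.trans (by gcongr)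
    have h3 := Real.log_le_log (by positivity) h2
    rw [Real.log_mul two_ne_zero (by positivity), Real.log_pow, Real.log_rpow two_pos] at h3
    have hm1' : (1 : ℝ) ≤ m := by exact_mod_cast hmpos
    have hdm : 1 ≤ d * m := one_le_mul_of_one_le_of_one_le hd hm1'
    nlinarith
  obtain ⟨V, hVcodim, hV⟩ := exists_submodule_orthogonal_spectrum hψ hX
  refine ⟨V, ?_, ?_⟩
  · refine hVcodim.trans ?_
    calc 8 * Real.log (N / X.card) ≤ 8 * (2 * (d * m)) := by gcongr
      _ ≤ 8 * (2 * (d * (7 * k * (1600 * d ^ 2 / ε ^ 2)))) := by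
          gcongr
          exact hm2.trans (by gcongr)
      _ = 179200 * (k * d ^ 3 / ε ^ 2) := by ring
      _ ≤ 200000 * (k * d ^ 3 / ε ^ 2) := by gcongr; norm_num
      _ = _ := by ring
  · intro v hv x
    set g := shiftAvg A (shiftAvg B f) with hg
    have hgx : ∀ y, (∑ a ∈ A, ∑ b ∈ B, f (y + a + b)) / ((A.card : ℝ) * (B.card : ℝ)) = g y := by
      intro y
      simp only [hg, shiftAvg, ← Finset.sum_div, div_div]
      rw [mul_comm]
    rw [hgx, hgx]
    have h1 := abs_iterate_shiftAvg_sub_le hX hper l (x + v)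
    have h2 := abs_iterate_shiftAvg_sub_le hX hper l x
    have h3 := abs_iterate_shiftAvg_add_sub_le hψ (B := B) hA hf l (hV v hv) x
    have hsmooth : (l : ℝ) * (2 * δ) = ε / 4 := by
      rw [hδ]; field_simp; norm_num
    have htail : 2 * (1 / 2 : ℝ) ^ l * √(N / A.card) ≤ ε / 2 := by
      have e1 : (1 / 2 : ℝ) ^ l ≤ (2 : ℝ) ^ (-(4 * d)) := by
        rw [one_div, inv_pow, ← Real.rpow_natCast, ← Real.rpow_neg two_pos.le]
        exact Real.rpow_le_rpow_of_exponent_le one_le_two (by linarith)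
      have e2 : √(N / A.card) ≤ (2 : ℝ) ^ d := by
        refine Real.sqrt_le_iff.2 ⟨by positivity, hNA.trans ?_⟩
        exact le_self_pow₀ (Real.one_le_rpow one_le_two (by linarith)) two_ne_zero
      calc 2 * (1 / 2 : ℝ) ^ l * √(N / A.card)
          ≤ 2 * (2 : ℝ) ^ (-(4 * d)) * (2 : ℝ) ^ d := by gcongr
        _ = (2 : ℝ) ^ (1 + -(4 * d) + d) := by
            rw [Real.rpow_add two_pos, Real.rpow_add two_pos, Real.rpow_one]
        _ ≤ (2 : ℝ) ^ (-d + -1) :=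
            Real.rpow_le_rpow_of_exponent_le one_le_two (by linarith)
        _ = (2 : ℝ) ^ (-d) / 2 := by
            rw [Real.rpow_add two_pos, Real.rpow_neg_one, div_eq_mul_inv]
        _ ≤ _ := by gcongr
    rw [hsmooth] at h1 h2
    rw [← hN, ← hg] at h3
    rw [abs_le] at *
    constructor <;> linarith [h1.1, h1.2, h2.1, h2.2, h3.1, h3.2]
end
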